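/- arXiv:2401.10734 — 2 statements merged into one kernel-verified Lean document; each statement's English description precedes it below -/
import Mathlib

section
/- Suppose (π, ν1, ν2) satisfies the basic adjoint relationship. Then the total masses of ν1 and ν2 are ν1((0,∞)) = (2/3)(2λ1 + λ2) and ν2((0,∞)) = (2/3)(λ1 + 2λ2). -/
open MeasureTheory Set

open Filter Topology

/-- The Laplace transform of a nonnegative function tends to the total mass at `0`. -/
lemma tendsto_integral_exp_neg_mul {α : Type*} [MeasurableSpace α] (μ : Measure α)
    [IsFiniteMeasure μ] {f : α → ℝ} (hf : Measurable f) (hf0 : ∀ᵐ a ∂μ, 0 ≤ f a) :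
    Tendsto (fun x : ℝ => ∫ a, Real.exp (-x * f a) ∂μ) (𝓝[>] 0) (𝓝 (μ.real univ)) := by
  have h : Tendsto (fun x : ℝ => ∫ a, Real.exp (-x * f a) ∂μ) (𝓝[>] 0)
      (𝓝 (∫ _, (1 : ℝ) ∂μ)) := by
    refine tendsto_integral_filter_of_dominated_convergence (fun _ => (1 : ℝ)) ?_ ?_
      (integrable_const _) ?_
    · exact Eventually.of_forall fun x => by fun_prop
    · filter_upwards [self_mem_nhdsWithin] with x (hx : 0 < x)
      filter_upwards [hf0] with a ha
      rw [Real.norm_eq_abs, Real.abs_exp, Real.exp_le_one_iff]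
      nlinarith [mul_nonneg hx.le ha]
    · refine Eventually.of_forall fun a => ?_
      have hc : Continuous fun x : ℝ => Real.exp (-x * f a) := by fun_prop
      simpa using (hc.tendsto 0).mono_left nhdsWithin_le_nhds
  simpa using h

/-- Dividing the restriction of the adjoint relationship to a coordinate axis by the coordinate
and letting it tend to `0` gives a linear relation between the limits. -/
lemma axis_relation_of_tendsto {l n m : ℝ} {P N : ℝ → ℝ}
    (hP : Tendsto P (𝓝[>] 0) (𝓝 1)) (hN : Tendsto N (𝓝[>] 0) (𝓝 m))
    (h : ∀ x > 0, (x ^ 2 + l * x) * P x = x * n - x / 2 * N x) :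
    l = n - m / 2 := by
  have hid : Tendsto (fun x : ℝ => x) (𝓝[>] 0) (𝓝 0) := nhdsWithin_le_nhds
  have h1 : Tendsto (fun x => (x + l) * P x) (𝓝[>] 0) (𝓝 ((0 + l) * 1)) :=
    (hid.add_const l).mul hP
  have h2 : Tendsto (fun x => n - N x / 2) (𝓝[>] 0) (𝓝 (n - m / 2)) :=
    (hN.div_const 2).const_sub n
  have h3 : (fun x => (x + l) * P x) =ᶠ[𝓝[>] 0] fun x => n - N x / 2 := by
    filter_upwards [self_mem_nhdsWithin] with x (hx : 0 < x)
    apply mul_left_cancel₀ hx.ne'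
    linear_combination h x hx
  simpa using tendsto_nhds_unique (h1.congr' h3) h2

/-- If `(π, ν1, ν2)` satisfies the basic adjoint relationship, then the total masses of
`ν1` and `ν2` are `ν1((0,∞)) = (2/3)(2λ1 + λ2)` and `ν2((0,∞)) = (2/3)(λ1 + 2λ2)`. -/
theorem total_masses_nu
    (l1 l2 : ℝ) (hl1 : 0 < l1) (hl2 : 0 < l2)
    (pim : Measure (ℝ × ℝ)) [IsProbabilityMeasure pim]
    (hpim : pim ((Ioi (0:ℝ) ×ˢ Ioi (0:ℝ))ᶜ) = 0)
    (nu1 nu2 : Measure ℝ) [IsFiniteMeasure nu1] [IsFiniteMeasure nu2]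
    (hnu1 : nu1 (Ioi (0:ℝ))ᶜ = 0) (hnu2 : nu2 (Ioi (0:ℝ))ᶜ = 0)
    (hBAR : ∀ x ≥ (0:ℝ), ∀ y ≥ (0:ℝ),
      ((x - y) ^ 2 + l1 * x + l2 * y) * (∫ p, Real.exp (-x * p.1 - y * p.2) ∂pim)
        = (x - y / 2) * (∫ u, Real.exp (-y * u) ∂nu1)
          + (y - x / 2) * (∫ u, Real.exp (-x * u) ∂nu2)) :
    nu1 (Ioi (0:ℝ)) = ENNReal.ofReal ((2 / 3) * (2 * l1 + l2)) ∧
    nu2 (Ioi (0:ℝ)) = ENNReal.ofReal ((2 / 3) * (l1 + 2 * l2)) := by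
  have hpos : ∀ᵐ p ∂pim, p ∈ Ioi (0 : ℝ) ×ˢ Ioi (0 : ℝ) := hpim
  have hpos1 : ∀ᵐ u ∂nu1, u ∈ Ioi (0 : ℝ) := hnu1
  have hpos2 : ∀ᵐ u ∂nu2, u ∈ Ioi (0 : ℝ) := hnu2
  have hP1 := tendsto_integral_exp_neg_mul pim measurable_fst (hpos.mono fun p hp => hp.1.le)
  have hP2 := tendsto_integral_exp_neg_mul pim measurable_snd (hpos.mono fun p hp => hp.2.le)
  have hN1 := tendsto_integral_exp_neg_mul nu1 measurable_id (hpos1.mono fun u hu => le_of_lt hu)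
  have hN2 := tendsto_integral_exp_neg_mul nu2 measurable_id (hpos2.mono fun u hu => le_of_lt hu)
  rw [probReal_univ] at hP1 hP2
  have e1 : l1 = nu1.real univ - nu2.real univ / 2 := by
    refine axis_relation_of_tendsto hP1 hN2 fun x hx => ?_
    have h := hBAR x hx.le 0 le_rfl
    simp only [neg_zero, zero_mul, sub_zero, Real.exp_zero, integral_const, smul_eq_mul] at h
    simp only [id]
    linear_combination h
  have e2 : l2 = nu2.real univ - nu1.real univ / 2 := by
    refine axis_relation_of_tendsto hP2 hN1 fun y hy => ?_
    have h := hBAR 0 le_rfl y hy.le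
    simp only [neg_zero, zero_mul, zero_sub, Real.exp_zero, integral_const, smul_eq_mul,
      ← neg_mul] at h
    simp only [id]
    linear_combination h
  have hmass : ∀ (ν : Measure ℝ) [IsFiniteMeasure ν], (∀ᵐ u ∂ν, u ∈ Ioi (0 : ℝ)) →
      ν (Ioi 0) = ENNReal.ofReal (ν.real univ) := fun ν _ hν => by
    rw [ofReal_measureReal]
    exact measure_congr (eventuallyEq_univ.2 hν)
  rw [hmass nu1 hpos1, hmass nu2 hpos2]
  constructor <;> congr 1 <;> linarith
end

section
/- Suppose (π, ν1, ν2) satisfies the basic adjoint relationship. Then for i ∈ {1,2} the measure νi is absolutely continuous with respect to Lebesgue measure on (0,∞), with density νi(u) = −(4(λ1+λ2)⁴/(3 λ1 λ2)) · Σ_{n∈ℤ} (n−1) n (n+1) (n−1+μi)(n+μi)(n+1+μi)(n+μi/2) · exp(−(n²+μi n)(λ1+λ2) u). -/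
open MeasureTheory Set

/-- The boundary density from Theorem 2 (general case), with parameter `μ`:
`u ↦ −(4(λ1+λ2)⁴/(3λ1λ2)) Σ_{n∈ℤ} (n−1)n(n+1)(n−1+μ)(n+μ)(n+1+μ)(n+μ/2)
  exp(−(n²+μn)(λ1+λ2)u)`. -/
noncomputable def boundaryDensity (l1 l2 mu : ℝ) (u : ℝ) : ℝ :=
  -(4 * (l1 + l2) ^ 4 / (3 * l1 * l2)) *
    ∑' n : ℤ, ((n : ℝ) - 1) * (n : ℝ) * ((n : ℝ) + 1) * ((n : ℝ) - 1 + mu)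
      * ((n : ℝ) + mu) * ((n : ℝ) + 1 + mu) * ((n : ℝ) + mu / 2)
      * Real.exp (-(((n : ℝ) ^ 2 + mu * (n : ℝ)) * (l1 + l2) * u))

section Laplace

open Complex Filter Topology

/-- Two functions holomorphic on the right half-plane which agree on the positive reals agree
on the whole half-plane. -/
theorem eqOn_rightHalfPlane_of_eq_ofReal {f g : ℂ → ℂ}
    (hf : DifferentiableOn ℂ f {z | 0 < z.re}) (hg : DifferentiableOn ℂ g {z | 0 < z.re})
    (h : ∀ x : ℝ, 0 < x → f x = g x) : EqOn f g {z | 0 < z.re} := by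
  have hopen : IsOpen {z : ℂ | 0 < z.re} := isOpen_lt continuous_const continuous_re
  refine (hf.analyticOnNhd hopen).eqOn_of_preconnected_of_frequently_eq
    (hg.analyticOnNhd hopen) (convex_halfSpace_re_gt 0).isPreconnected
    (z₀ := 1) (by simp) ?_
  have hlim : Tendsto (fun n : ℕ => ((1 + 1 / ((n : ℝ) + 1) : ℝ) : ℂ)) atTop (𝓝[≠] 1) := by
    refine tendsto_nhdsWithin_iff.2 ⟨?_, Eventually.of_forall fun n => ?_⟩
    · have : Tendsto (fun n : ℕ => (1 + 1 / ((n : ℝ) + 1) : ℝ)) atTop (𝓝 (1 + 0)) :=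
        tendsto_const_nhds.add tendsto_one_div_add_atTop_nhds_zero_nat
      have h2 := (continuous_ofReal.tendsto (1 + 0 : ℝ)).comp this
      simpa [Function.comp_def] using h2
    · have : (0 : ℝ) < 1 / ((n : ℝ) + 1) := by positivity
      intro hc
      have hc' : ((1 + 1 / ((n : ℝ) + 1) : ℝ) : ℂ) = ((1 : ℝ) : ℂ) := by simpa using hc
      have := ofReal_injective hc'
      linarith
  refine hlim.frequently (Frequently.of_forall fun n => h _ ?_)
  positivity

theorem norm_mul_exp_neg_le {c z : ℂ} {t : ℝ} (hc : ‖c‖ ≤ 1) (hz : 0 ≤ z.re) (ht : 0 ≤ t) :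
    ‖c * cexp (-z * t)‖ ≤ 1 := by
  rw [norm_mul, norm_exp]
  have : (-z * (t : ℂ)).re ≤ 0 := by
    simp only [mul_re, neg_re, ofReal_re, neg_im, ofReal_im, mul_zero, sub_zero]
    nlinarith
  calc _ ≤ 1 * 1 := mul_le_mul hc (Real.exp_le_one_iff.2 this) (Real.exp_nonneg _) zero_le_one
    _ = 1 := one_mul 1

theorem aestronglyMeasurable_mul_exp_neg {α : Type*} [MeasurableSpace α] {m : Measure α}
    {g : α → ℝ} {φ : α → ℂ} (hg : AEMeasurable g m)
    (hφ : AEStronglyMeasurable φ m) (z : ℂ) :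
    AEStronglyMeasurable (fun a => φ a * cexp (-z * g a)) m := by
  have : AEMeasurable (fun a => cexp (-z * g a)) m := by fun_prop
  exact hφ.mul this.aestronglyMeasurable

variable {α : Type*} [MeasurableSpace α] {m : Measure α} [IsFiniteMeasure m]

/-- Laplace transforms of bounded weights are holomorphic on the right half-plane. -/
theorem differentiableOn_integral_mul_exp_neg {g : α → ℝ} {φ : α → ℂ} (hg : AEMeasurable g m)
    (hg0 : ∀ᵐ a ∂m, 0 ≤ g a) (hφ : AEStronglyMeasurable φ m) (hφ1 : ∀ᵐ a ∂m, ‖φ a‖ ≤ 1) :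
    DifferentiableOn ℂ (fun z => ∫ a, φ a * cexp (-z * g a) ∂m) {z | 0 < z.re} := by
  intro z₀ hz₀
  have hz₀ : 0 < z₀.re := hz₀
  have hs : {z : ℂ | z₀.re / 2 < z.re} ∈ 𝓝 z₀ :=
    (isOpen_lt continuous_const continuous_re).mem_nhds (by simpa using by linarith)
  have key := hasDerivAt_integral_of_dominated_loc_of_deriv_le (μ := m) (x₀ := z₀)
    (F := fun z a => φ a * cexp (-z * g a))
    (F' := fun z a => φ a * cexp (-z * g a) * (-(g a : ℂ)))
    (bound := fun _ => 2 / z₀.re) hs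
    (Eventually.of_forall fun z => aestronglyMeasurable_mul_exp_neg hg hφ z)
    (Integrable.of_bound (aestronglyMeasurable_mul_exp_neg hg hφ z₀) 1 (by
      filter_upwards [hg0, hφ1] with a h0 h1 using norm_mul_exp_neg_le h1 hz₀.le h0))
    ((aestronglyMeasurable_mul_exp_neg hg hφ z₀).mul (by
      have : AEMeasurable (fun a => -(g a : ℂ)) m := by fun_prop
      exact this.aestronglyMeasurable))
    (by
      filter_upwards [hg0, hφ1] with a h0 h1 z hz
      have hz : z₀.re / 2 < z.re := hz
      rw [norm_mul, norm_mul, norm_neg, norm_exp, norm_real, Real.norm_of_nonneg h0]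
      have hre : (-z * (g a : ℂ)).re = -(z.re * g a) := by simp
      rw [hre, Real.exp_neg]
      have hE : z₀.re / 2 * g a ≤ Real.exp (z.re * g a) := by
        have := Real.add_one_le_exp (z.re * g a)
        nlinarith
      have hpos := Real.exp_pos (z.re * g a)
      have : (Real.exp (z.re * g a))⁻¹ * g a ≤ 2 / z₀.re := by
        rw [inv_mul_le_iff₀ hpos]
        calc g a = 2 / z₀.re * (z₀.re / 2 * g a) := by field_simp
          _ ≤ 2 / z₀.re * Real.exp (z.re * g a) := by gcongr
          _ = _ := by ring
      calc _ = ‖φ a‖ * ((Real.exp (z.re * g a))⁻¹ * g a) := by ring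
        _ ≤ 1 * (2 / z₀.re) := by gcongr
        _ = _ := one_mul _)
    (integrable_const _)
    (by
      filter_upwards with a z _
      have h1 : HasDerivAt (fun z : ℂ => -z * (g a : ℂ)) (-(g a : ℂ)) z := by
        simpa using (hasDerivAt_id z).neg.mul_const (g a : ℂ)
      simpa [mul_assoc] using (h1.cexp.const_mul (φ a)))
  exact key.2.differentiableAt.differentiableWithinAt

theorem continuousOn_integral_mul_exp_neg {g : α → ℝ} {φ : α → ℂ} (hg : AEMeasurable g m)
    (hg0 : ∀ᵐ a ∂m, 0 ≤ g a) (hφ : AEStronglyMeasurable φ m) (hφ1 : ∀ᵐ a ∂m, ‖φ a‖ ≤ 1) :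
    ContinuousOn (fun z => ∫ a, φ a * cexp (-z * g a) ∂m) {z | 0 ≤ z.re} := by
  refine continuousOn_of_dominated (bound := fun _ => 1)
    (fun z _ => aestronglyMeasurable_mul_exp_neg hg hφ z) (fun z hz => ?_)
    (integrable_const _) ?_
  · filter_upwards [hg0, hφ1] with a h0 h1 using norm_mul_exp_neg_le h1 hz h0
  · filter_upwards with a
    fun_prop

/-- The Laplace transform of a measure on the line, at a complex argument. -/
noncomputable def laplace (ν : Measure ℝ) (z : ℂ) : ℂ := ∫ u, cexp (-z * u) ∂ν

variable {ν : Measure ℝ} [IsFiniteMeasure ν]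

theorem ae_pos_of_compl_Ioi {ν : Measure ℝ} (hν : ν (Ioi (0 : ℝ))ᶜ = 0) : ∀ᵐ u ∂ν, 0 < u := by
  have : ∀ᵐ u ∂ν, u ∈ Ioi (0 : ℝ) := by rwa [ae_iff]
  exact this

theorem differentiableOn_laplace (hν : ∀ᵐ u ∂ν, 0 < u) :
    DifferentiableOn ℂ (laplace ν) {z | 0 < z.re} := by
  have := differentiableOn_integral_mul_exp_neg (m := ν) (g := id) (φ := fun _ => 1)
    aemeasurable_id (hν.mono fun _ h => h.le) aestronglyMeasurable_const (by simp)
  simp only [one_mul, id] at this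
  exact this

theorem continuousOn_laplace (hν : ∀ᵐ u ∂ν, 0 < u) :
    ContinuousOn (laplace ν) {z | 0 ≤ z.re} := by
  have := continuousOn_integral_mul_exp_neg (m := ν) (g := id) (φ := fun _ => 1)
    aemeasurable_id (hν.mono fun _ h => h.le) aestronglyMeasurable_const (by simp)
  simp only [one_mul, id] at this
  exact this

theorem norm_laplace_le (hν : ∀ᵐ u ∂ν, 0 < u) {z : ℂ} (hz : 0 ≤ z.re) :
    ‖laplace ν z‖ ≤ ν.real univ := by
  have := norm_integral_le_of_norm_le_const (μ := ν) (f := fun u : ℝ => cexp (-z * u)) (C := 1) (by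
    filter_upwards [hν] with u hu
    simpa using norm_mul_exp_neg_le (c := 1) (by simp) hz hu.le)
  simpa [laplace] using this

theorem laplace_ofReal (ν : Measure ℝ) (x : ℝ) :
    laplace ν x = ((∫ u, Real.exp (-x * u) ∂ν : ℝ) : ℂ) := by
  rw [laplace, ← integral_complex_ofReal]
  simp

/-- A finite measure on the half-line is determined by its Laplace transform on `(0,∞)`. -/
theorem ext_of_integral_exp_neg_eq {m₁ m₂ : Measure ℝ} [IsFiniteMeasure m₁] [IsFiniteMeasure m₂]
    (h₁ : ∀ᵐ u ∂m₁, 0 < u) (h₂ : ∀ᵐ u ∂m₂, 0 < u)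
    (h : ∀ x : ℝ, 0 < x → ∫ u, Real.exp (-x * u) ∂m₁ = ∫ u, Real.exp (-x * u) ∂m₂) :
    m₁ = m₂ := by
  have hopen : EqOn (laplace m₁) (laplace m₂) {z | 0 < z.re} :=
    eqOn_rightHalfPlane_of_eq_ofReal (differentiableOn_laplace h₁) (differentiableOn_laplace h₂)
      fun x hx => by rw [laplace_ofReal, laplace_ofReal, h x hx]
  have hclosed : EqOn (laplace m₁) (laplace m₂) {z | 0 ≤ z.re} := by
    refine hopen.of_subset_closure (continuousOn_laplace h₁) (continuousOn_laplace h₂)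
      (fun z (hz : 0 < z.re) => hz.le) ?_
    rw [closure_setOfPred_lt_re]
  refine Measure.ext_of_charFun (funext fun t => ?_)
  have := hclosed (x := -(t * I)) (by simp)
  simpa [laplace, charFun_apply_real, mul_assoc, mul_comm, mul_left_comm] using this

end Laplace

section Strip

open Complex Filter Topology

/-- A holomorphic function on the strip `-m₁ < re s < m₂`, symmetric about the midlines
`re s = m₂ / 2` and `re s = -m₁ / 2` of its two halves and decaying at `± i∞`, vanishes. -/
theorem eq_zero_of_reflection_symmetric {m₁ m₂ : ℝ} (hm₁ : 0 < m₁) (hm₂ : 0 < m₂) {h : ℂ → ℂ}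
    (hd : DifferentiableOn ℂ h {s | -m₁ < s.re ∧ s.re < m₂})
    (hr : ∀ s : ℂ, 0 < s.re → s.re < m₂ → h (m₂ - s) = h s)
    (hl : ∀ s : ℂ, -m₁ < s.re → s.re < 0 → h (-m₁ - s) = h s)
    (hdecay : ∀ ε > 0, ∃ T : ℝ, ∀ s : ℂ, -m₁ < s.re → s.re < m₂ → T ≤ |s.im| → ‖h s‖ < ε)
    {s : ℂ} (hs₁ : -m₁ < s.re) (hs₂ : s.re < m₂) : h s = 0 := by
  set Ω : Set ℂ := {s | -m₁ < s.re ∧ s.re < m₂} with hΩ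
  by_contra hne
  have hpos : 0 < ‖h s‖ := norm_pos_iff.2 hne
  have fold : ∀ s ∈ Ω, ∃ s' : ℂ, (-m₁ / 2 ≤ s'.re ∧ s'.re ≤ m₂ / 2) ∧ h s' = h s := by
    rintro s ⟨h1, h2⟩
    by_cases hA : m₂ / 2 < s.re
    · exact ⟨m₂ - s, ⟨by simp; linarith, by simp; linarith⟩, hr s (by linarith) h2⟩
    by_cases hB : s.re < -m₁ / 2
    · exact ⟨-m₁ - s, ⟨by simp; linarith, by simp; linarith⟩, hl s h1 (by linarith)⟩
    · exact ⟨s, ⟨not_lt.1 hB, not_lt.1 hA⟩, rfl⟩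
  obtain ⟨T, hT⟩ := hdecay _ hpos
  set K : Set ℂ := Icc (-m₁ / 2) (m₂ / 2) ×ℂ Icc (-T) T with hK
  have hKc : IsCompact K := isCompact_Icc.reProdIm isCompact_Icc
  have hKΩ : K ⊆ Ω := by
    intro z hz
    rw [hK, mem_reProdIm] at hz
    exact ⟨by linarith [hz.1.1], by linarith [hz.1.2]⟩
  have small : ∀ z : ℂ, (-m₁ / 2 ≤ z.re ∧ z.re ≤ m₂ / 2) → z ∉ K → ‖h z‖ < ‖h s‖ := by
    intro z hz hzK
    refine hT z (by linarith [hz.1]) (by linarith [hz.2]) ?_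
    by_contra hlt
    exact hzK (mem_reProdIm.2 ⟨hz, abs_le.1 (not_le.1 hlt).le⟩)
  obtain ⟨s', hs', hss'⟩ := fold s ⟨hs₁, hs₂⟩
  have hs'K : s' ∈ K := by
    by_contra hn
    have := small s' hs' hn
    rw [hss'] at this
    exact lt_irrefl _ this
  obtain ⟨c, hcK, hc⟩ := hKc.exists_isMaxOn ⟨s', hs'K⟩ (hd.continuousOn.mono hKΩ).norm
  have hsc : ‖h s‖ ≤ ‖h c‖ := hss' ▸ hc hs'K
  have hmax : IsMaxOn (norm ∘ h) Ω c := by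
    intro z hz
    obtain ⟨z', hz', hzz'⟩ := fold z hz
    change ‖h z‖ ≤ ‖h c‖
    rw [← hzz']
    by_cases hzK : z' ∈ K
    · exact hc hzK
    · exact (small z' hz' hzK).le.trans hsc
  have hopen : IsOpen Ω :=
    (isOpen_lt continuous_const continuous_re).inter (isOpen_lt continuous_re continuous_const)
  have hconv : Convex ℝ Ω := (convex_halfSpace_re_gt (-m₁)).inter (convex_halfSpace_re_lt m₂)
  have hconst := Complex.eqOn_of_isPreconnected_of_isMaxOn_norm hconv.isPreconnected hopen hd
    (hKΩ hcK) hmax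
  have hT' := hT ⟨0, |T|⟩ (by simpa using hm₁) hm₂ (by simpa using le_abs_self T)
  have hz : h ⟨0, |T|⟩ = h c := hconst (show -m₁ < (0 : ℝ) ∧ (0 : ℝ) < m₂ from ⟨by linarith, hm₂⟩)
  rw [hz] at hT'
  exact absurd hsc (not_le.2 hT')

theorem abs_im_le_norm_sin (z : ℂ) : |z.im| ≤ ‖Complex.sin z‖ := by
  have h1 : ‖Complex.sin z‖ ^ 2 = Real.sin z.re ^ 2 + Real.sinh z.im ^ 2 := by
    rw [Complex.sq_norm, normSq_apply, Complex.sin_eq]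
    simp only [← ofReal_sin, ← ofReal_cosh, ← ofReal_cos, ← ofReal_sinh, ← ofReal_mul, add_re, add_im,
      ofReal_re, ofReal_im, re_ofReal_mul, im_ofReal_mul, I_re, I_im]
    have := Real.cosh_sq z.im
    have := Real.sin_sq_add_cos_sq z.re
    ring_nf
    grind
  have h2 : |z.im| ≤ |Real.sinh z.im| := by
    rw [Real.abs_sinh]
    exact Real.self_le_sinh_iff.2 (abs_nonneg _)
  refine h2.trans (abs_le_of_sq_le_sq ?_ (norm_nonneg _) |>.trans le_rfl)
  rw [h1]
  nlinarith [sq_nonneg (Real.sin z.re)]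

theorem sin_pi_mul_ne_zero_of_abs_re_lt {s : ℂ} (h1 : -1 < s.re) (h2 : s.re < 1) (h0 : s ≠ 0) :
    Complex.sin (Real.pi * s) ≠ 0 := by
  intro h
  obtain ⟨k, hk⟩ := Complex.sin_eq_zero_iff.1 h
  have hpi : (Real.pi : ℂ) ≠ 0 := by exact_mod_cast Real.pi_ne_zero
  have hs : s = k := mul_left_cancel₀ hpi (by rw [hk]; ring)
  rw [hs, intCast_re] at h1 h2
  have : k = 0 := by
    have h1' : -1 < k := by exact_mod_cast h1
    have h2' : k < 1 := by exact_mod_cast h2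
    omega
  exact h0 (by rw [hs, this]; simp)

end Strip

section Kernel

open Complex Filter Topology

/-- Uniqueness for the functional equation on the uniformized kernel curve
`x = s (m₂ - s)`, `y = -s (s + m₁)`. -/
theorem kernel_functional_equation_solution {m₁ m₂ M : ℝ} (hm₁ : 0 < m₁) (hm₂ : 0 < m₂)
    (hsum : m₁ + m₂ = 1) {a b : ℂ → ℂ}
    (ha : DifferentiableOn ℂ a {z | 0 < z.re}) (hb : DifferentiableOn ℂ b {z | 0 < z.re})
    (hac : ContinuousOn a {z | 0 ≤ z.re}) (hbc : ContinuousOn b {z | 0 ≤ z.re})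
    (haM : ∀ z : ℂ, 0 ≤ z.re → ‖a z‖ ≤ M) (hbM : ∀ z : ℂ, 0 ≤ z.re → ‖b z‖ ≤ M)
    (hfe : ∀ s : ℂ, 0 < (s * (m₂ - s)).re → 0 < (-s * (s + m₁)).re →
      (1 + m₂ - s) * a (-s * (s + m₁)) = (s + 1 + m₁) * b (s * (m₂ - s)))
    (h0 : (1 + m₂) * a 0 = (1 + m₁) * b 0) {s : ℂ} (hs₁ : 0 < s.re) (hs₂ : s.re < m₂) :
    (1 + m₂) * m₁ * m₂ *
        (b (s * (m₂ - s)) * (sin (Real.pi * s) * sin (Real.pi * (m₂ - s)))) =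
      -(b 0 * (Real.pi * sin (Real.pi * m₂))) *
        (s * (s - 1) * (s + 1) * (s - 1 - m₂) * (s - m₂) * (s + 1 - m₂)) := by
  have hm₁' : m₁ = 1 - m₂ := by linarith
  have hm₁c : (m₁ : ℂ) = 1 - m₂ := by rw [hm₁']; simp
  have hM : 0 ≤ M := (norm_nonneg _).trans (haM 0 (by simp))
  have reX : ∀ s : ℂ, (s * (m₂ - s)).re = s.re * (m₂ - s.re) + s.im ^ 2 := by
    intro s; simp; ring
  have reY : ∀ s : ℂ, (-s * (s + m₁)).re = -s.re * (s.re + m₁) + s.im ^ 2 := by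
    intro s; simp; ring
  have ne_of_re : ∀ {z : ℂ}, z.re ≠ 0 → z ≠ 0 := by rintro z hz rfl; simp at hz
  set Ω : Set ℂ := {s | -m₁ < s.re ∧ s.re < m₂} with hΩ
  have hopen : IsOpen Ω :=
    (isOpen_lt continuous_const continuous_re).inter (isOpen_lt continuous_re continuous_const)
  have h0Ω : (0 : ℂ) ∈ Ω := ⟨by simpa using hm₁, by simpa using hm₂⟩
  have hΩ0 : Ω ∈ 𝓝 (0 : ℂ) := hopen.mem_nhds h0Ω
  obtain ⟨r₁, hr₁⟩ : ∃ r : ℂ → ℂ, r = fun s : ℂ =>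
    -((s - 1) * (s + 1) * (s - m₂) * (s + m₁) * (s + 1 + m₁)) := ⟨_, rfl⟩
  obtain ⟨r₂, hr₂⟩ : ∃ r : ℂ → ℂ, r = fun s : ℂ =>
    (s - 1) * (s + 1) * (s - 1 - m₂) * (s - m₂) * (s + 1 - m₂) := ⟨_, rfl⟩
  have hr₁d : Differentiable ℂ r₁ := by rw [hr₁]; fun_prop
  have hr₂d : Differentiable ℂ r₂ := by rw [hr₂]; fun_prop
  have hr₁0 : ∀ s ∈ Ω, r₁ s ≠ 0 := by
    rintro s ⟨h1, h2⟩
    simp only [hr₁]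
    refine neg_ne_zero.2 (mul_ne_zero (mul_ne_zero (mul_ne_zero (mul_ne_zero ?_ ?_) ?_) ?_) ?_) <;>
    · apply ne_of_re; simp; linarith
  have hr₂0 : ∀ s ∈ Ω, r₂ s ≠ 0 := by
    rintro s ⟨h1, h2⟩
    simp only [hr₂]
    refine mul_ne_zero (mul_ne_zero (mul_ne_zero (mul_ne_zero ?_ ?_) ?_) ?_) ?_ <;>
    · apply ne_of_re; simp; linarith
  have hrr : ∀ s : ℂ, r₁ s * (1 + m₂ - s) = r₂ s * (s + 1 + m₁) := by
    intro s; simp only [hr₁, hr₂, hm₁c]; ring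
  obtain ⟨q, hq⟩ : ∃ q : ℂ → ℂ, q = fun s =>
    dslope (fun s : ℂ => sin (Real.pi * s)) 0 s * sin (Real.pi * (m₂ - s)) := ⟨_, rfl⟩
  have hq_ne : ∀ s : ℂ, s ≠ 0 → s * q s = sin (Real.pi * s) * sin (Real.pi * (m₂ - s)) := by
    intro s hs
    simp only [hq, dslope_of_ne _ hs, slope_def_field]
    simp
    field_simp
  have hq0 : q 0 = Real.pi * sin (Real.pi * m₂) := by
    have hd : HasDerivAt (fun s : ℂ => sin (Real.pi * s)) (Real.pi : ℂ) 0 := by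
      have h1 : HasDerivAt (fun s : ℂ => (Real.pi : ℂ) * s) (Real.pi : ℂ) 0 := by
        simpa using (hasDerivAt_id (0 : ℂ)).const_mul (Real.pi : ℂ)
      simpa using h1.csin
    simp [hq, dslope_same, hd.deriv]
  have hqd : Differentiable ℂ q := by
    have h1 : Differentiable ℂ (dslope (fun s : ℂ => sin (Real.pi * s)) 0) := by
      rw [← differentiableOn_univ, differentiableOn_dslope univ_mem]
      exact Differentiable.differentiableOn (by fun_prop)
    rw [hq]
    fun_prop
  have hpi : (Real.pi : ℂ) ≠ 0 := by exact_mod_cast Real.pi_ne_zero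
  have hsin_ne : ∀ s ∈ Ω, s ≠ 0 → sin (Real.pi * s) * sin (Real.pi * (m₂ - s)) ≠ 0 := by
    rintro s ⟨h1, h2⟩ hs
    refine mul_ne_zero (sin_pi_mul_ne_zero_of_abs_re_lt (by linarith) (by linarith) hs)
      (sin_pi_mul_ne_zero_of_abs_re_lt ?_ ?_ (ne_of_re ?_)) <;> simp <;> linarith
  have hqΩ : ∀ s ∈ Ω, q s ≠ 0 := by
    intro s hs
    by_cases h : s = 0
    · rw [h, hq0]
      refine mul_ne_zero hpi (sin_pi_mul_ne_zero_of_abs_re_lt ?_ ?_ (ne_of_re ?_)) <;> simp <;>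
        linarith
    · exact right_ne_zero_of_mul (hq_ne s h ▸ hsin_ne s hs h)
  obtain ⟨f₂, hf₂⟩ : ∃ f : ℂ → ℂ, f = fun s => b (s * (m₂ - s)) / r₂ s := ⟨_, rfl⟩
  obtain ⟨f₁, hf₁⟩ : ∃ f : ℂ → ℂ, f = fun s => a (-s * (s + m₁)) / r₁ s := ⟨_, rfl⟩
  have hff : ∀ s ∈ Ω, 0 < (s * (m₂ - s)).re → 0 < (-s * (s + m₁)).re → f₁ s = f₂ s := by
    intro s hs hx hy
    simp only [hf₁, hf₂]
    rw [div_eq_div_iff (hr₁0 s hs) (hr₂0 s hs)]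
    have hne : (1 + m₂ - s : ℂ) ≠ 0 := ne_of_re (by simp; linarith [hs.2])
    apply mul_left_cancel₀ hne
    linear_combination r₂ s * hfe s hx hy - b (s * (m₂ - s)) * hrr s
  have hff0 : f₁ 0 = f₂ 0 := by
    simp only [hf₁, hf₂]
    rw [div_eq_div_iff (hr₁0 0 h0Ω) (hr₂0 0 h0Ω)]
    have hne : (1 + m₂ : ℂ) ≠ 0 := ne_of_re (by simp; linarith)
    apply mul_left_cancel₀ hne
    have := hrr 0
    simp only [neg_zero, zero_mul, zero_add, sub_zero] at this ⊢
    linear_combination r₂ 0 * h0 - b 0 * this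
  have hf₂d : ∀ s ∈ Ω, 0 < (s * (m₂ - s)).re → DifferentiableAt ℂ f₂ s := by
    intro s hs hx
    rw [hf₂]
    refine DifferentiableAt.fun_div ?_ hr₂d.differentiableAt (hr₂0 s hs)
    exact DifferentiableAt.comp s (g := b) (f := fun s : ℂ => s * (m₂ - s))
      ((hb _ hx).differentiableAt
        ((isOpen_lt continuous_const continuous_re).mem_nhds hx)) (by fun_prop)
  have hf₁d : ∀ s ∈ Ω, 0 < (-s * (s + m₁)).re → DifferentiableAt ℂ f₁ s := by
    intro s hs hx
    rw [hf₁]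
    refine DifferentiableAt.fun_div ?_ hr₁d.differentiableAt (hr₁0 s hs)
    exact DifferentiableAt.comp s (g := a) (f := fun s : ℂ => -s * (s + m₁))
      ((ha _ hx).differentiableAt
        ((isOpen_lt continuous_const continuous_re).mem_nhds hx)) (by fun_prop)
  obtain ⟨G, hG⟩ : ∃ G : ℂ → ℂ, G = fun s => if 0 ≤ s.re then f₂ s else f₁ s := ⟨_, rfl⟩
  have hG₂ : ∀ s : ℂ, 0 ≤ s.re → G s = f₂ s := fun s hs => by simp [hG, hs]
  have hG₁ : ∀ s : ℂ, s.re < 0 → G s = f₁ s := fun s hs => by simp [hG, hs]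
  have hGd : DifferentiableOn ℂ G (Ω \ {0}) := by
    rintro s ⟨hs, hs0⟩
    refine DifferentiableAt.differentiableWithinAt ?_
    rcases lt_trichotomy s.re 0 with hre | hre | hre
    · have hy : 0 < (-s * (s + m₁)).re := by
        rw [reY]; nlinarith [mul_pos (neg_pos.2 hre) (by linarith [hs.1] : 0 < s.re + m₁),
          sq_nonneg s.im]
      refine (hf₁d s hs hy).congr_of_eventuallyEq ?_
      filter_upwards [(isOpen_lt continuous_re continuous_const).mem_nhds hre] with z hz
      exact hG₁ z hz
    · have him : s.im ≠ 0 := fun h => hs0 (Complex.ext hre h)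
      have hx : 0 < (s * (m₂ - s)).re := by rw [reX, hre]; simpa using sq_pos_of_ne_zero him
      have hy : 0 < (-s * (s + m₁)).re := by rw [reY, hre]; simpa using sq_pos_of_ne_zero him
      refine (hf₂d s hs hx).congr_of_eventuallyEq ?_
      have cx : Continuous fun s : ℂ => (s * (m₂ - s)).re := by fun_prop
      have cy : Continuous fun s : ℂ => (-s * (s + m₁)).re := by fun_prop
      filter_upwards [(isOpen_lt continuous_const cx).mem_nhds hx,
        (isOpen_lt continuous_const cy).mem_nhds hy, hopen.mem_nhds hs] with z hzx hzy hz
      by_cases h : 0 ≤ z.re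
      · exact hG₂ z h
      · rw [hG₁ z (not_le.1 h)]
        exact hff z hz hzx hzy
    · have hx : 0 < (s * (m₂ - s)).re := by
        rw [reX]; nlinarith [mul_pos hre (by linarith [hs.2] : 0 < m₂ - s.re), sq_nonneg s.im]
      refine (hf₂d s hs hx).congr_of_eventuallyEq ?_
      filter_upwards [(isOpen_lt continuous_const continuous_re).mem_nhds hre] with z hz
      exact hG₂ z (le_of_lt hz)
  have hGc : ContinuousAt G 0 := by
    have hA : ContinuousWithinAt G {s | 0 ≤ s.re ∧ s.re < m₂} 0 := by
      have : ContinuousWithinAt f₂ {s | 0 ≤ s.re ∧ s.re < m₂} 0 := by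
        rw [hf₂]
        refine ContinuousWithinAt.div ?_ hr₂d.continuous.continuousWithinAt (hr₂0 0 h0Ω)
        refine ContinuousWithinAt.comp (g := b) (f := fun s : ℂ => s * (m₂ - s))
          (t := {z | 0 ≤ z.re}) (by simpa using hbc 0 (by simp))
          (Continuous.continuousWithinAt (by fun_prop)) ?_
        rintro z ⟨h1, h2⟩
        rw [mem_ofPred_eq, reX]
        nlinarith [mul_nonneg h1 (by linarith : 0 ≤ m₂ - z.re), sq_nonneg z.im]
      exact this.congr (fun z hz => hG₂ z hz.1) (hG₂ 0 (by simp))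
    have hB : ContinuousWithinAt G {s | -m₁ < s.re ∧ s.re < 0} 0 := by
      have : ContinuousWithinAt f₁ {s | -m₁ < s.re ∧ s.re < 0} 0 := by
        rw [hf₁]
        refine ContinuousWithinAt.div ?_ hr₁d.continuous.continuousWithinAt (hr₁0 0 h0Ω)
        refine ContinuousWithinAt.comp (g := a) (f := fun s : ℂ => -s * (s + m₁))
          (t := {z | 0 ≤ z.re}) (by simpa using hac 0 (by simp))
          (Continuous.continuousWithinAt (by fun_prop)) ?_
        rintro z ⟨h1, h2⟩
        rw [mem_ofPred_eq, reY]
        nlinarith [mul_pos (neg_pos.2 h2) (by linarith : 0 < z.re + m₁), sq_nonneg z.im]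
      exact this.congr (fun z hz => hG₁ z hz.2) (by rw [hG₂ 0 (by simp), hff0])
    refine (hA.union hB).continuousAt (mem_of_superset hΩ0 ?_)
    rintro z ⟨h1, h2⟩
    by_cases h : 0 ≤ z.re
    · exact Or.inl ⟨h, h2⟩
    · exact Or.inr ⟨h1, not_le.1 h⟩
  have hGΩ : DifferentiableOn ℂ G Ω :=
    (differentiableOn_compl_singleton_and_continuousAt_iff hΩ0).1 ⟨hGd, hGc⟩
  obtain ⟨C, hC⟩ : ∃ C : ℂ, C = G 0 * q 0 := ⟨_, rfl⟩
  obtain ⟨H, hH⟩ : ∃ H : ℂ → ℂ, H = fun s => G s - C / q s := ⟨_, rfl⟩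
  have hHΩ : DifferentiableOn ℂ H Ω := by
    rw [hH]
    exact hGΩ.sub ((differentiableOn_const C).div hqd.differentiableOn hqΩ)
  have hH0 : H 0 = 0 := by
    have := hqΩ 0 h0Ω
    simp only [hH, hC]
    field_simp
    ring
  have hh : ∀ s : ℂ, s ≠ 0 → dslope H 0 s =
      G s / s - C / (sin (Real.pi * s) * sin (Real.pi * (m₂ - s))) := by
    intro s hs
    rw [dslope_of_ne _ hs, slope_def_field, hH0, ← hq_ne s hs, hH, sub_zero, sub_zero, sub_div,
      div_div, mul_comm s]
  have hzero : dslope H 0 s = 0 := by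
    refine eq_zero_of_reflection_symmetric hm₁ hm₂ ((differentiableOn_dslope hΩ0).2 hHΩ)
      ?_ ?_ ?_ (by linarith) hs₂
    · intro s h1 h2
      rw [hh s (ne_of_re h1.ne'), hh (m₂ - s) (ne_of_re (by simp; linarith)), hG₂ s h1.le,
        hG₂ (m₂ - s) (by simp; linarith)]
      simp only [hf₂, hr₂, div_div, sub_sub_cancel]
      congr 1
      · rw [mul_comm s]
        congr 1
        ring
      · rw [mul_comm (sin _)]
    · intro s h1 h2
      rw [hh s (ne_of_re h2.ne), hh (-m₁ - s) (ne_of_re (by simp; linarith)), hG₁ s h2,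
        hG₁ (-m₁ - s) (by simp; linarith)]
      simp only [hf₁, hr₁, div_div]
      congr 1
      · congr 1
        · congr 1; ring
        · rw [hm₁c]; ring
      · have e1 : (Real.pi : ℂ) * (-m₁ - s) = Real.pi * (m₂ - s) - Real.pi := by
          rw [hm₁c]; ring
        have e2 : (Real.pi : ℂ) * (m₂ - (-m₁ - s)) = Real.pi * s + Real.pi := by
          rw [hm₁c]; ring
        rw [e1, e2, sin_sub_pi, sin_add_pi]
        congr 1
        ring
    · intro ε hε
      refine ⟨(M + ‖C‖) / ε + 1, fun s h1 h2 hT => ?_⟩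
      set t := |s.im| with ht
      have hK : 0 ≤ (M + ‖C‖) / ε := by positivity
      have ht1 : 1 ≤ t := by linarith
      have ht0 : 0 < t := by linarith
      have hs0 : s ≠ 0 := by rintro rfl; simp [ht] at ht0
      have ht6 : t ≤ t ^ 6 := le_self_pow₀ ht1 (by norm_num)
      have ht2 : t ≤ Real.pi * t * (Real.pi * t) := by
        have : 1 ≤ Real.pi * t := by nlinarith [Real.pi_gt_three]
        nlinarith [Real.pi_gt_three]
      have imb : ∀ z : ℂ, z.im = s.im → t ≤ ‖z‖ := fun z hz => by
        rw [ht, ← hz]; exact abs_im_le_norm z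
      have bG : ‖G s / s‖ ≤ M / t := by
        by_cases h : 0 ≤ s.re
        · rw [hG₂ s h, hf₂]
          simp only [div_div]
          rw [norm_div]
          refine div_le_div₀ hM (hbM _ ?_) ht0 (ht6.trans ?_)
          · rw [reX]; nlinarith [mul_nonneg h (by linarith : 0 ≤ m₂ - s.re), sq_nonneg s.im]
          · simp only [hr₂, norm_mul]
            calc t ^ 6 = t * t * t * t * t * t := by ring
              _ ≤ _ := by gcongr <;> exact imb _ (by simp)
        · have h := not_le.1 h
          rw [hG₁ s h, hf₁]
          simp only [div_div]
          rw [norm_div]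
          refine div_le_div₀ hM (haM _ ?_) ht0 (ht6.trans ?_)
          · rw [reY]; nlinarith [mul_pos (neg_pos.2 h) (by linarith : 0 < s.re + m₁), sq_nonneg s.im]
          · simp only [hr₁, norm_mul, norm_neg]
            calc t ^ 6 = t * t * t * t * t * t := by ring
              _ ≤ _ := by gcongr <;> exact imb _ (by simp)
      have bS : ‖C / (sin (Real.pi * s) * sin (Real.pi * (m₂ - s)))‖ ≤ ‖C‖ / t := by
        rw [norm_div, norm_mul]
        refine div_le_div_of_nonneg_left (norm_nonneg _) ht0 (ht2.trans ?_)
        have i1 : |((Real.pi : ℂ) * s).im| = Real.pi * t := by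
          rw [im_ofReal_mul, abs_mul, abs_of_pos Real.pi_pos]
        have i2 : |((Real.pi : ℂ) * (m₂ - s)).im| = Real.pi * t := by
          rw [im_ofReal_mul, abs_mul, abs_of_pos Real.pi_pos]; simp [ht]
        gcongr
        · exact i1 ▸ abs_im_le_norm_sin _
        · exact i2 ▸ abs_im_le_norm_sin _
      rw [hh s hs0]
      calc _ ≤ M / t + ‖C‖ / t := (norm_sub_le _ _).trans (add_le_add bG bS)
        _ = (M + ‖C‖) / t := by ring
        _ < ε := by
          rw [div_lt_iff₀ ht0, ← div_lt_iff₀' hε]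
          linarith
  have hsΩ : s ∈ Ω := ⟨by linarith, hs₂⟩
  have hs0 : s ≠ 0 := ne_of_re hs₁.ne'
  rw [hh s hs0, hG₂ s hs₁.le, sub_eq_zero, hf₂] at hzero
  simp only [div_div] at hzero
  rw [div_eq_div_iff (mul_ne_zero (hr₂0 s hsΩ) hs0) (hsin_ne s hsΩ hs0)] at hzero
  have hC' : C * -((1 + m₂) * m₁ * m₂) = b 0 * (Real.pi * sin (Real.pi * m₂)) := by
    have e : r₂ 0 = -((1 + m₂) * m₁ * m₂) := by simp only [hr₂, hm₁c]; ring
    rw [hC, hG₂ 0 (by simp), hq0, ← e]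
    have := hr₂0 0 h0Ω
    simp only [hf₂, zero_mul]
    field_simp
  have e2 : s * (s - 1) * (s + 1) * (s - 1 - m₂) * (s - m₂) * (s + 1 - m₂) = r₂ s * s := by
    simp only [hr₂]; ring
  rw [e2]
  linear_combination ((1 + m₂) * m₁ * m₂) * hzero - (r₂ s * s) * hC'
end Kernel

section BAR

open Complex Filter Topology

variable {l₁ l₂ : ℝ} {π : Measure (ℝ × ℝ)} {ν₁ ν₂ : Measure ℝ}

/-- The basic adjoint relationship for the triple `(π, ν₁, ν₂)`. -/
def BasicAdjointRelationship (l₁ l₂ : ℝ) (π : Measure (ℝ × ℝ)) (ν₁ ν₂ : Measure ℝ) : Prop :=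
  ∀ x ≥ (0 : ℝ), ∀ y ≥ (0 : ℝ),
    ((x - y) ^ 2 + l₁ * x + l₂ * y) * (∫ p, Real.exp (-x * p.1 - y * p.2) ∂π)
      = (x - y / 2) * (∫ u, Real.exp (-y * u) ∂ν₁) + (y - x / 2) * (∫ u, Real.exp (-x * u) ∂ν₂)

theorem BasicAdjointRelationship.complex [IsFiniteMeasure π] [IsFiniteMeasure ν₁]
    [IsFiniteMeasure ν₂] (h : BasicAdjointRelationship l₁ l₂ π ν₁ ν₂)
    (hπ : ∀ᵐ p ∂π, 0 < p.1 ∧ 0 < p.2) (hν₁ : ∀ᵐ u ∂ν₁, 0 < u) (hν₂ : ∀ᵐ u ∂ν₂, 0 < u)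
    {x y : ℂ} (hx : 0 < x.re) (hy : 0 < y.re) :
    ((x - y) ^ 2 + l₁ * x + l₂ * y) * (∫ p, cexp (-x * p.1) * cexp (-y * p.2) ∂π)
      = (x - y / 2) * laplace ν₁ y + (y - x / 2) * laplace ν₂ x := by
  have hπ₁ : ∀ᵐ p ∂π, 0 ≤ p.1 := hπ.mono fun p hp => hp.1.le
  have hπ₂ : ∀ᵐ p ∂π, 0 ≤ p.2 := hπ.mono fun p hp => hp.2.le
  have hdπ₁ : ∀ y : ℂ, 0 < y.re →
      DifferentiableOn ℂ (fun x => ∫ p, cexp (-x * p.1) * cexp (-y * p.2) ∂π) {z | 0 < z.re} := by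
    intro y hy
    have := differentiableOn_integral_mul_exp_neg (m := π) (g := Prod.fst)
      (φ := fun p => cexp (-y * p.2)) (by fun_prop) hπ₁ (by fun_prop) (by
        filter_upwards [hπ₂] with p hp
        simpa using norm_mul_exp_neg_le (c := 1) (by simp) hy.le hp)
    simpa only [mul_comm] using this
  have hdπ₂ : ∀ x : ℂ, 0 < x.re →
      DifferentiableOn ℂ (fun y => ∫ p, cexp (-x * p.1) * cexp (-y * p.2) ∂π) {z | 0 < z.re} := by
    intro x hx
    exact differentiableOn_integral_mul_exp_neg (m := π) (g := Prod.snd)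
      (φ := fun p => cexp (-x * p.1)) (by fun_prop) hπ₂ (by fun_prop) (by
        filter_upwards [hπ₁] with p hp
        simpa using norm_mul_exp_neg_le (c := 1) (by simp) hx.le hp)
  have hreal : ∀ x y : ℝ, 0 < x → 0 < y →
      (((x : ℂ) - y) ^ 2 + l₁ * x + l₂ * y) *
          (∫ p, cexp (-(x : ℂ) * p.1) * cexp (-(y : ℂ) * p.2) ∂π)
        = (x - y / 2) * laplace ν₁ y + (y - x / 2) * laplace ν₂ x := by
    intro x y hx hy
    have e : (∫ p, cexp (-(x : ℂ) * p.1) * cexp (-(y : ℂ) * p.2) ∂π)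
        = ((∫ p, Real.exp (-x * p.1 - y * p.2) ∂π : ℝ) : ℂ) := by
      rw [← integral_complex_ofReal]
      refine integral_congr_ae (Eventually.of_forall fun p => ?_)
      push_cast
      rw [← Complex.exp_add]
      ring_nf
    rw [e, laplace_ofReal, laplace_ofReal]
    exact_mod_cast h x hx.le y hy.le
  have hd₁ := differentiableOn_laplace hν₁
  have hd₂ := differentiableOn_laplace hν₂
  have hx_step : ∀ y : ℝ, 0 < y → ∀ x : ℂ, 0 < x.re →
      ((x - y) ^ 2 + l₁ * x + l₂ * y) * (∫ p, cexp (-x * p.1) * cexp (-(y : ℂ) * p.2) ∂π)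
        = (x - y / 2) * laplace ν₁ y + (y - x / 2) * laplace ν₂ x := by
    intro y hy x hx
    refine eqOn_rightHalfPlane_of_eq_ofReal
      (f := fun x => ((x - y) ^ 2 + l₁ * x + l₂ * y) *
        (∫ p, cexp (-x * p.1) * cexp (-(y : ℂ) * p.2) ∂π))
      (g := fun x => (x - y / 2) * laplace ν₁ y + (y - x / 2) * laplace ν₂ x)
      (DifferentiableOn.fun_mul (by fun_prop) (hdπ₁ y (by simpa using hy))) ?_
      (fun x hx => hreal x y hx hy) hx
    exact DifferentiableOn.fun_add (by fun_prop) (DifferentiableOn.fun_mul (by fun_prop) hd₂)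
  refine eqOn_rightHalfPlane_of_eq_ofReal
    (f := fun y => ((x - y) ^ 2 + l₁ * x + l₂ * y) *
      (∫ p, cexp (-x * p.1) * cexp (-y * p.2) ∂π))
    (g := fun y => (x - y / 2) * laplace ν₁ y + (y - x / 2) * laplace ν₂ x)
    (DifferentiableOn.fun_mul (by fun_prop) (hdπ₂ x hx)) ?_
    (fun y hy => hx_step y hy x hx) hy
  exact DifferentiableOn.fun_add (DifferentiableOn.fun_mul (by fun_prop) hd₁) (by fun_prop)

theorem BasicAdjointRelationship.swap (h : BasicAdjointRelationship l₁ l₂ π ν₁ ν₂) :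
    BasicAdjointRelationship l₂ l₁ (π.map Prod.swap) ν₂ ν₁ := by
  intro x hx y hy
  have e : ∫ p, Real.exp (-x * p.1 - y * p.2) ∂(π.map Prod.swap)
      = ∫ p, Real.exp (-y * p.1 - x * p.2) ∂π := by
    rw [integral_map (by fun_prop) (by fun_prop)]
    refine integral_congr_ae (Eventually.of_forall fun p => ?_)
    simp only [Prod.fst_swap, Prod.snd_swap]
    congr 1
    ring
  rw [e]
  linear_combination h y hy x hx

theorem tendsto_integral_exp_neg [IsFiniteMeasure ν₂] (hν₂ : ∀ᵐ u ∂ν₂, 0 < u) :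
    Tendsto (fun x : ℝ => ∫ u, Real.exp (-x * u) ∂ν₂) (𝓝[>] 0) (𝓝 (ν₂.real univ)) := by
  have h := continuousOn_laplace hν₂ 0 (by simp)
  have h0 : laplace ν₂ 0 = ν₂.real univ := by simp [laplace]
  have h1 : Tendsto (fun x : ℝ => (x : ℂ)) (𝓝[>] 0) (𝓝[{z | 0 ≤ z.re}] 0) := by
    refine tendsto_nhdsWithin_iff.2 ⟨?_, ?_⟩
    · exact (by simpa using continuous_ofReal.tendsto 0 :
        Tendsto (fun x : ℝ => (x : ℂ)) (𝓝 0) (𝓝 0)).mono_left nhdsWithin_le_nhds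
    · filter_upwards [self_mem_nhdsWithin] with x hx
      simpa using le_of_lt hx
  have h2 := (continuous_re.tendsto _).comp (h.tendsto.comp h1)
  simpa [Function.comp_def, laplace_ofReal, h0] using h2

theorem BasicAdjointRelationship.drift_eq [IsProbabilityMeasure π] [IsFiniteMeasure ν₂]
    (h : BasicAdjointRelationship l₁ l₂ π ν₁ ν₂)
    (hπ : ∀ᵐ p ∂π, 0 < p.1 ∧ 0 < p.2) (hν₂ : ∀ᵐ u ∂ν₂, 0 < u) :
    l₁ = ν₁.real univ - ν₂.real univ / 2 := by
  have key : ∀ x : ℝ, 0 < x → (x + l₁) * (∫ u, Real.exp (-x * u) ∂(π.map Prod.fst))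
      = ν₁.real univ - (∫ u, Real.exp (-x * u) ∂ν₂) / 2 := by
    intro x hx
    have e := h x hx.le 0 le_rfl
    rw [integral_map (by fun_prop) (by fun_prop)]
    apply mul_left_cancel₀ hx.ne'
    simp only [zero_mul, sub_zero, neg_zero, Real.exp_zero, integral_const, smul_eq_mul, mul_one,
      mul_zero, add_zero, zero_div, zero_sub] at e
    linear_combination e
  have hm : ∀ᵐ u ∂(π.map Prod.fst), 0 < u := by
    rw [ae_map_iff (by fun_prop) measurableSet_Ioi]
    exact hπ.mono fun p hp => hp.1
  have : IsProbabilityMeasure (π.map Prod.fst) :=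
    Measure.isProbabilityMeasure_map (by fun_prop)
  have t1 : Tendsto (fun x : ℝ => (x + l₁) * (∫ u, Real.exp (-x * u) ∂(π.map Prod.fst)))
      (𝓝[>] 0) (𝓝 ((0 + l₁) * (π.map Prod.fst).real univ)) :=
    ((tendsto_id.mono_left nhdsWithin_le_nhds).add_const l₁).mul (tendsto_integral_exp_neg hm)
  have t2 : Tendsto (fun x : ℝ => ν₁.real univ - (∫ u, Real.exp (-x * u) ∂ν₂) / 2)
      (𝓝[>] 0) (𝓝 (ν₁.real univ - ν₂.real univ / 2)) :=
    ((tendsto_integral_exp_neg hν₂).div_const 2).const_sub _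
  have := tendsto_nhds_unique (t1.congr' (by
    filter_upwards [self_mem_nhdsWithin] with x hx using key x hx)) t2
  simpa using this

end BAR

section Transform

open Complex Filter Topology

theorem hasSum_partial_fractions_sin_mul_sin {s m : ℂ} (hs : s ∈ integerComplement)
    (hms : m - s ∈ integerComplement) :
    HasSum (fun n : ℕ => (2 * (n + 1) + m) / (s * (m - s) + ((n + 1) ^ 2 + m * (n + 1))) +
        (2 * (-(n + 1)) + m) / (s * (m - s) + ((-(n + 1)) ^ 2 + m * (-(n + 1)))))
      (Real.pi * sin (Real.pi * m) / (sin (Real.pi * s) * sin (Real.pi * (m - s)))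
        - m / (s * (m - s))) := by
  have hne : ∀ z ∈ integerComplement, ∀ n : ℕ, z - (n + 1) ≠ 0 ∧ z + (n + 1) ≠ 0 := by
    intro z hz n
    have h1 := integerComplement_add_ne_zero hz (n + 1)
    have h2 := integerComplement_add_ne_zero hz (-(n + 1))
    push_cast at h1 h2
    exact ⟨by simpa [sub_eq_add_neg] using h2, h1⟩
  have h1 := (summable_cotTerm hs).hasSum
  have h2 := (summable_cotTerm hms).hasSum
  rw [show ∑' n, cotTerm s n = _ from (cot_series_rep' hs).symm] at h1
  rw [show ∑' n, cotTerm (m - s) n = _ from (cot_series_rep' hms).symm] at h2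
  have h := h1.add h2
  have hs0 : s ≠ 0 := integerComplement.ne_zero hs
  have hms0 : m - s ≠ 0 := integerComplement.ne_zero hms
  have hsin := sin_pi_mul_ne_zero hs
  have hsin' := sin_pi_mul_ne_zero hms
  convert h using 1
  · funext n
    obtain ⟨a1, a2⟩ := hne s hs n
    obtain ⟨b1, b2⟩ := hne _ hms n
    have e1 : s * (m - s) + (((n : ℂ) + 1) ^ 2 + m * (n + 1))
        = (s + (n + 1)) * (m - s + (n + 1)) := by ring
    have e2 : s * (m - s) + ((-((n : ℂ) + 1)) ^ 2 + m * (-(n + 1)))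
        = (s - (n + 1)) * (m - s - (n + 1)) := by ring
    rw [e1, e2, cotTerm, cotTerm]
    field_simp
    ring
  · have hadd : sin (Real.pi * m) = sin (Real.pi * s) * cos (Real.pi * (m - s))
        + cos (Real.pi * s) * sin (Real.pi * (m - s)) := by
      rw [← Complex.sin_add]; congr 1; ring
    rw [hadd, cot, cot]
    field_simp
    ring

variable {l₁ l₂ : ℝ} {π : Measure (ℝ × ℝ)} {ν₁ ν₂ : Measure ℝ}

theorem ae_pos_map_swap (hπ : ∀ᵐ p ∂π, 0 < p.1 ∧ 0 < p.2) :
    ∀ᵐ p ∂(π.map Prod.swap), 0 < p.1 ∧ 0 < p.2 := by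
  have hmeas : MeasurableSet {p : ℝ × ℝ | 0 < p.1 ∧ 0 < p.2} :=
    measurableSet_Ioi.prod measurableSet_Ioi
  rw [ae_map_iff (by fun_prop) hmeas]
  exact hπ.mono fun p hp => hp.symm

theorem BasicAdjointRelationship.laplace_mul_sin [IsProbabilityMeasure π] [IsFiniteMeasure ν₁]
    [IsFiniteMeasure ν₂] (h : BasicAdjointRelationship l₁ l₂ π ν₁ ν₂)
    (hl₁ : 0 < l₁) (hl₂ : 0 < l₂)
    (hπ : ∀ᵐ p ∂π, 0 < p.1 ∧ 0 < p.2) (hν₁ : ∀ᵐ u ∂ν₁, 0 < u) (hν₂ : ∀ᵐ u ∂ν₂, 0 < u)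
    {L m₁ m₂ : ℝ} (hL : L = l₁ + l₂) (hm₁ : m₁ = l₁ / L) (hm₂ : m₂ = l₂ / L)
    {s : ℂ} (hs₁ : 0 < s.re) (hs₂ : s.re < m₂) :
    3 * m₁ * m₂ * (laplace ν₂ (L * (s * (m₂ - s))) *
        (sin (Real.pi * s) * sin (Real.pi * (m₂ - s)))) =
      -(2 * L * (Real.pi * sin (Real.pi * m₂))) *
        (s * (s - 1) * (s + 1) * (s - 1 - m₂) * (s - m₂) * (s + 1 - m₂)) := by
  have hLpos : 0 < L := by rw [hL]; positivity
  have hm₁pos : 0 < m₁ := by rw [hm₁]; positivity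
  have hm₂pos : 0 < m₂ := by rw [hm₂]; positivity
  have e₁ : l₁ = L * m₁ := by rw [hm₁]; field_simp
  have e₂ : l₂ = L * m₂ := by rw [hm₂]; field_simp
  have hsum : m₁ + m₂ = 1 := by
    have : L * (m₁ + m₂) = L * 1 := by rw [mul_add, ← e₁, ← e₂, mul_one, hL]
    exact mul_left_cancel₀ hLpos.ne' this
  have hd₁ := h.drift_eq hπ hν₂
  have : IsProbabilityMeasure (π.map Prod.swap) :=
    Measure.isProbabilityMeasure_map (by fun_prop)
  have hd₂ := h.swap.drift_eq (ae_pos_map_swap hπ) hν₁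
  have hmass₁ : ν₁.real univ = 2 * L / 3 * (1 + m₁) := by
    linear_combination -(4 / 3 * hd₁) - 2 / 3 * hd₂ + 4 / 3 * e₁ + 2 / 3 * e₂
      + 2 / 3 * L * hsum
  have hmass₂ : ν₂.real univ = 2 * L / 3 * (1 + m₂) := by
    linear_combination -(4 / 3 * hd₂) - 2 / 3 * hd₁ + 4 / 3 * e₂ + 2 / 3 * e₁
      + 2 / 3 * L * hsum
  have hscale : ∀ z : ℂ, ((L : ℂ) * z).re = L * z.re := fun z => by simp
  have hmaps : MapsTo (fun z : ℂ => (L : ℂ) * z) {z | 0 < z.re} {z | 0 < z.re} := by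
    intro z hz
    simpa [hscale] using mul_pos hLpos hz
  have hmapsc : MapsTo (fun z : ℂ => (L : ℂ) * z) {z | 0 ≤ z.re} {z | 0 ≤ z.re} := by
    intro z hz
    simpa [hscale] using mul_nonneg hLpos.le hz
  have h0₁ : laplace ν₁ (L * 0) = ν₁.real univ := by simp [laplace]
  have h0₂ : laplace ν₂ (L * 0) = ν₂.real univ := by simp [laplace]
  have hsumc : (m₁ : ℂ) + m₂ = 1 := by exact_mod_cast hsum
  have key := kernel_functional_equation_solution (M := max (ν₁.real univ) (ν₂.real univ))
    hm₁pos hm₂pos hsum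
    (a := fun z => laplace ν₁ (L * z)) (b := fun z => laplace ν₂ (L * z))
    ((differentiableOn_laplace hν₁).comp (by fun_prop) hmaps)
    ((differentiableOn_laplace hν₂).comp (by fun_prop) hmaps)
    ((continuousOn_laplace hν₁).comp (by fun_prop) hmapsc)
    ((continuousOn_laplace hν₂).comp (by fun_prop) hmapsc)
    (fun z hz => (norm_laplace_le hν₁ (hmapsc hz)).trans (le_max_left _ _))
    (fun z hz => (norm_laplace_le hν₂ (hmapsc hz)).trans (le_max_right _ _))
    (by
      intro s hx hy
      have hc := h.complex hπ hν₁ hν₂ (hmaps hx) (hmaps hy)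
      have hs0 : s ≠ 0 := by rintro rfl; simp at hx
      have hLc : (L : ℂ) ≠ 0 := by exact_mod_cast hLpos.ne'
      have hm : (m₁ : ℂ) = 1 - m₂ := by rw [← hsumc]; ring
      have hker : ((L * (s * (m₂ - s)) - L * (-s * (s + m₁))) ^ 2 + l₁ * (L * (s * (m₂ - s)))
          + l₂ * (L * (-s * (s + m₁))) : ℂ) = 0 := by
        rw [e₁, e₂]; push_cast; rw [hm]; ring
      simp only at hc
      rw [hker, zero_mul] at hc
      apply mul_left_cancel₀ (mul_ne_zero hLc hs0)
      rw [hm] at hc ⊢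
      linear_combination -2 * hc)
    (by
      simp only [h0₁, h0₂, hmass₁, hmass₂]
      push_cast
      ring) hs₁ hs₂
  simp only [h0₂, hmass₂] at key
  have hne : (1 + m₂ : ℂ) ≠ 0 := by exact_mod_cast (by positivity : (1 + m₂) ≠ 0)
  apply mul_left_cancel₀ hne
  push_cast at key
  linear_combination 3 * key

/-- The Laplace transform of the boundary measure as a series of partial fractions. -/
theorem BasicAdjointRelationship.exists_hasSum_integral_exp_neg [IsProbabilityMeasure π]
    [IsFiniteMeasure ν₁] [IsFiniteMeasure ν₂] (h : BasicAdjointRelationship l₁ l₂ π ν₁ ν₂)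
    (hl₁ : 0 < l₁) (hl₂ : 0 < l₂)
    (hπ : ∀ᵐ p ∂π, 0 < p.1 ∧ 0 < p.2) (hν₁ : ∀ᵐ u ∂ν₁, 0 < u) (hν₂ : ∀ᵐ u ∂ν₂, 0 < u)
    {L m₁ m : ℝ} (hL : L = l₁ + l₂) (hm₁ : m₁ = l₁ / L) (hm : m = l₂ / L)
    {ξ : ℝ} (hξ : m ^ 2 / 4 < ξ) :
    ∃ K : ℝ, HasSum (fun n : ℕ => (2 * (n + 1) + m) / (ξ + ((n + 1) ^ 2 + m * (n + 1))) +
        (2 * (-(n + 1)) + m) / (ξ + ((-(n + 1)) ^ 2 + m * (-(n + 1))))) (K - m / ξ) ∧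
      3 * m₁ * m * ∫ u, Real.exp (-(L * ξ) * u) ∂ν₂
        = 2 * L * (ξ * (ξ + 1 - m) * (ξ + 1 + m)) * K := by
  have hLpos : 0 < L := by rw [hL]; positivity
  have hmpos : 0 < m := by rw [hm]; positivity
  have hm_lt : m < 1 := by rw [hm, hL, div_lt_one (by positivity)]; linarith
  set τ := Real.sqrt (ξ - m ^ 2 / 4) with hτ
  have hτ2 : τ ^ 2 = ξ - m ^ 2 / 4 := Real.sq_sqrt (by linarith)
  set s : ℂ := m / 2 + τ * I with hs
  have hsre : s.re = m / 2 := by simp [hs]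
  have hnot : ∀ z : ℂ, z.re = m / 2 → z ∈ integerComplement := by
    rintro z hz ⟨n, rfl⟩
    rw [Complex.intCast_re] at hz
    have h1 : (0 : ℝ) < n := by rw [hz]; positivity
    have h2 : (n : ℝ) < 1 := by rw [hz]; linarith
    have h3 : 0 < n := by exact_mod_cast h1
    have h4 : n < 1 := by exact_mod_cast h2
    omega
  have hsc := hnot s hsre
  have hmsc : (m : ℂ) - s ∈ integerComplement := hnot _ (by simp [hsre]; ring)
  have hξs : s * (m - s) = ξ := by
    have h1 : ((τ : ℂ)) ^ 2 = ξ - m ^ 2 / 4 := by exact_mod_cast hτ2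
    rw [hs]
    linear_combination h1 - (τ : ℂ) ^ 2 * I_sq
  have hS := hasSum_partial_fractions_sin_mul_sin hsc hmsc
  have hF := h.laplace_mul_sin hl₁ hl₂ hπ hν₁ hν₂ hL hm₁ hm (s := s)
    (by rw [hsre]; positivity) (by rw [hsre]; linarith)
  have hR : s * (s - 1) * (s + 1) * (s - 1 - m) * (s - m) * (s + 1 - m)
      = -((ξ * (ξ + 1 - m) * (ξ + 1 + m) : ℝ) : ℂ) := by
    push_cast
    rw [← hξs]
    ring
  have hsin := mul_ne_zero (sin_pi_mul_ne_zero hsc) (sin_pi_mul_ne_zero hmsc)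
  rw [hR, hξs] at hF
  rw [hξs] at hS
  set K : ℂ := Real.pi * sin (Real.pi * m) / (sin (Real.pi * s) * sin (Real.pi * (m - s))) with hK
  have hKS : K * (sin (Real.pi * s) * sin (Real.pi * (m - s))) = Real.pi * sin (Real.pi * m) :=
    div_mul_cancel₀ _ hsin
  have hF' : ((3 * m₁ * m * ∫ u, Real.exp (-(L * ξ) * u) ∂ν₂ : ℝ) : ℂ)
      = (2 * L * (ξ * (ξ + 1 - m) * (ξ + 1 + m)) : ℝ) * K := by
    apply mul_right_cancel₀ hsin
    have e : laplace ν₂ (L * ξ) = ((∫ u, Real.exp (-(L * ξ) * u) ∂ν₂ : ℝ) : ℂ) := by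
      rw [← laplace_ofReal]; push_cast; rfl
    rw [e] at hF
    push_cast at hF ⊢
    linear_combination hF - (2 * L * (ξ * (ξ + 1 - m) * (ξ + 1 + m))) * hKS
  refine ⟨K.re, ?_, ?_⟩
  · have := Complex.hasSum_re hS
    convert this using 1
    · funext n
      rw [← Complex.ofReal_re (_ + _)]
      push_cast
      rfl
    · rw [Complex.sub_re, ← Complex.ofReal_div, Complex.ofReal_re]
  · have := congrArg Complex.re hF'
    rwa [Complex.ofReal_re, Complex.re_ofReal_mul] at this

end Transform

section Differences

open Filter Topology

/-- The coefficients of the exponential series defining `boundaryDensity`. -/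
noncomputable def boundaryCoeff (m : ℝ) (n : ℤ) : ℝ :=
  ((n : ℝ) - 1) * n * (n + 1) * (n - 1 + m) * (n + m) * (n + 1 + m) * (n + m / 2)

/-- The Laplace transform at `ξ` of `(1 - exp (-u)) ^ 4 * exp (-(n ^ 2 + m * n) * u)`, times the
coefficient `boundaryCoeff m n`. -/
noncomputable def boundaryTerm (m ξ : ℝ) (n : ℤ) : ℝ :=
  boundaryCoeff m n * (24 / ((ξ + (n ^ 2 + m * n)) * (ξ + (n ^ 2 + m * n) + 1) *
    (ξ + (n ^ 2 + m * n) + 2) * (ξ + (n ^ 2 + m * n) + 3) * (ξ + (n ^ 2 + m * n) + 4)))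

theorem int_sq_add_mul_nonneg {m : ℝ} (hm₀ : 0 ≤ m) (hm₁ : m ≤ 1) (n : ℤ) :
    0 ≤ (n : ℝ) ^ 2 + m * n := by
  rcases le_or_gt 0 n with hn | hn
  · have : (0 : ℝ) ≤ n := by exact_mod_cast hn
    positivity
  · have : (n : ℝ) ≤ -1 := by exact_mod_cast (by omega : n ≤ -1)
    nlinarith

theorem fourth_difference_inv {x : ℝ} (hx : 0 < x) :
    1 / x - 4 * (1 / (x + 1)) + 6 * (1 / (x + 2)) - 4 * (1 / (x + 3)) + 1 / (x + 4)
      = 24 / (x * (x + 1) * (x + 2) * (x + 3) * (x + 4)) := by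
  field_simp
  ring

theorem fourth_difference_cubic_div {m ξ : ℝ} {n : ℤ} (h : 0 < ξ + ((n : ℝ) ^ 2 + m * n))
    {f : ℝ → ℝ}
    (hf : ∀ x, f x = x * (x + 1 - m) * (x + 1 + m) * ((2 * n + m) / (x + (n ^ 2 + m * n)))) :
    f ξ - 4 * f (ξ + 1) + 6 * f (ξ + 2) - 4 * f (ξ + 3) + f (ξ + 4)
      = -2 * boundaryTerm m ξ n := by
  set a := (n : ℝ) ^ 2 + m * n with ha
  have hdiv : ∀ x, 0 < x + a → f x = (2 * n + m) * (x ^ 2 + (2 - a) * x + (1 - m ^ 2 - a * (2 - a)))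
      - 2 * boundaryCoeff m n * (1 / (x + a)) := by
    intro x hx
    rw [hf, boundaryCoeff]
    field_simp
    rw [ha]
    ring
  rw [hdiv ξ h, hdiv (ξ + 1) (by linarith), hdiv (ξ + 2) (by linarith), hdiv (ξ + 3) (by linarith),
    hdiv (ξ + 4) (by linarith), boundaryTerm, ← ha, ← fourth_difference_inv h]
  have e : ∀ c : ℝ, ξ + c + a = ξ + a + c := fun c => by ring
  simp only [e]
  ring

theorem abs_boundaryTerm_le {m ξ : ℝ} (hm₀ : 0 ≤ m) (hm₁ : m ≤ 1) (hξ : m ^ 2 / 4 < ξ) (n : ℤ) :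
    |boundaryTerm m ξ n| ≤ 48 / ((n : ℝ) ^ 2 + 1) := by
  have ha := int_sq_add_mul_nonneg hm₀ hm₁ n
  set a := (n : ℝ) ^ 2 + m * n with hadef
  have hξ0 : 0 < ξ := lt_of_le_of_lt (by positivity) hξ
  set A := ξ + a with hA
  have hApos : 0 < A := by positivity
  set t := (n : ℝ) + m / 2 with ht
  have hcoeff : boundaryCoeff m n = a * (a - 1 + m) * (a - 1 - m) * t := by
    rw [boundaryCoeff, hadef, ht]; ring
  have htA : t ^ 2 ≤ A := by rw [hA, ht, hadef]; nlinarith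
  have htA' : |t| ≤ A + 3 := by
    rw [abs_le]; constructor <;> nlinarith [sq_nonneg (t - 1), sq_nonneg (t + 1)]
  have hn : (n : ℝ) ^ 2 + 1 ≤ 2 * (A + 4) := by
    have : (n : ℝ) = t - m / 2 := by rw [ht]; ring
    rw [this]
    nlinarith [sq_nonneg (t + m / 2)]
  rw [boundaryTerm, hcoeff, ← hadef, ← hA, abs_mul,
    abs_of_pos (by positivity : 0 < 24 / (A * (A + 1) * (A + 2) * (A + 3) * (A + 4))),
    abs_mul, abs_mul, abs_mul, abs_of_nonneg ha]
  have h1 : a ≤ A := by linarith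
  have h2 : |a - 1 + m| ≤ A + 1 := by rw [abs_le]; constructor <;> linarith
  have h3 : |a - 1 - m| ≤ A + 2 := by rw [abs_le]; constructor <;> linarith
  calc a * |a - 1 + m| * |a - 1 - m| * |t| * (24 / (A * (A + 1) * (A + 2) * (A + 3) * (A + 4)))
      ≤ A * (A + 1) * (A + 2) * (A + 3) * (24 / (A * (A + 1) * (A + 2) * (A + 3) * (A + 4))) := by
        gcongr
    _ = 24 / (A + 4) := by field_simp
    _ ≤ 48 / ((n : ℝ) ^ 2 + 1) := by
        rw [div_le_div_iff₀ (by positivity) (by positivity)]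
        linarith

theorem summable_boundaryTerm {m ξ : ℝ} (hm₀ : 0 ≤ m) (hm₁ : m ≤ 1) (hξ : m ^ 2 / 4 < ξ) :
    Summable (boundaryTerm m ξ) := by
  have hs : Summable fun n : ℤ => 48 * (1 / (n : ℝ) ^ 2) :=
    (Real.summable_one_div_int_pow.2 one_lt_two).mul_left _
  refine hs.of_norm_bounded_eventually ?_
  filter_upwards [(Set.finite_singleton (0 : ℤ)).compl_mem_cofinite] with n hn
  have hn0 : (n : ℝ) ≠ 0 := by exact_mod_cast hn
  refine (abs_boundaryTerm_le hm₀ hm₁ hξ n).trans ?_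
  rw [← mul_one_div]
  gcongr
  linarith

theorem exp_mul_one_sub_exp_pow_four (L ξ u : ℝ) :
    Real.exp (-(L * ξ) * u) * (1 - Real.exp (-L * u)) ^ 4
      = Real.exp (-(L * ξ) * u) - 4 * Real.exp (-(L * (ξ + 1)) * u)
        + 6 * Real.exp (-(L * (ξ + 2)) * u) - 4 * Real.exp (-(L * (ξ + 3)) * u)
        + Real.exp (-(L * (ξ + 4)) * u) := by
  have e : ∀ j : ℝ, Real.exp (-(L * (ξ + j)) * u)
      = Real.exp (-(L * ξ) * u) * Real.exp (j * (-L * u)) := by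
    intro j
    rw [← Real.exp_add]
    ring_nf
  have e2 := Real.exp_nat_mul (-L * u) 2
  have e3 := Real.exp_nat_mul (-L * u) 3
  have e4 := Real.exp_nat_mul (-L * u) 4
  push_cast at e2 e3 e4
  simp only [e, e2, e3, e4, one_mul]
  ring

theorem integral_exp_mul_one_sub_exp_pow_four {μ : Measure ℝ} {L ξ : ℝ}
    (hint : ∀ j : ℝ, 0 ≤ j → Integrable (fun u => Real.exp (-(L * (ξ + j)) * u)) μ) :
    ∫ u, Real.exp (-(L * ξ) * u) * (1 - Real.exp (-L * u)) ^ 4 ∂μ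
      = (∫ u, Real.exp (-(L * ξ) * u) ∂μ) - 4 * (∫ u, Real.exp (-(L * (ξ + 1)) * u) ∂μ)
        + 6 * (∫ u, Real.exp (-(L * (ξ + 2)) * u) ∂μ)
        - 4 * (∫ u, Real.exp (-(L * (ξ + 3)) * u) ∂μ)
        + (∫ u, Real.exp (-(L * (ξ + 4)) * u) ∂μ) := by
  have i₀ : Integrable (fun u => Real.exp (-(L * ξ) * u)) μ := by simpa using hint 0 le_rfl
  have i₁ := (hint 1 (by norm_num)).const_mul 4
  have i₂ := (hint 2 (by norm_num)).const_mul 6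
  have i₃ := (hint 3 (by norm_num)).const_mul 4
  have i₄ := hint 4 (by norm_num)
  simp only [exp_mul_one_sub_exp_pow_four]
  rw [integral_add, integral_sub, integral_add, integral_sub]
  · simp only [integral_const_mul]
  all_goals fun_prop

variable {l₁ l₂ : ℝ} {π : Measure (ℝ × ℝ)} {ν₁ ν₂ : Measure ℝ}

theorem BasicAdjointRelationship.integral_exp_mul_pow_four [IsProbabilityMeasure π]
    [IsFiniteMeasure ν₁] [IsFiniteMeasure ν₂] (h : BasicAdjointRelationship l₁ l₂ π ν₁ ν₂)
    (hl₁ : 0 < l₁) (hl₂ : 0 < l₂)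
    (hπ : ∀ᵐ p ∂π, 0 < p.1 ∧ 0 < p.2) (hν₁ : ∀ᵐ u ∂ν₁, 0 < u) (hν₂ : ∀ᵐ u ∂ν₂, 0 < u)
    {L m₁ m : ℝ} (hL : L = l₁ + l₂) (hm₁ : m₁ = l₁ / L) (hm : m = l₂ / L)
    {ξ : ℝ} (hξ : m ^ 2 / 4 < ξ) :
    3 * m₁ * m * ∫ u, Real.exp (-(L * ξ) * u) * (1 - Real.exp (-L * u)) ^ 4 ∂ν₂
      = -(4 * L) * ∑' n, boundaryTerm m ξ n := by
  have hLpos : 0 < L := by rw [hL]; positivity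
  have hmpos : 0 < m := by rw [hm]; positivity
  have hm_lt : m < 1 := by rw [hm, hL, div_lt_one (by positivity)]; linarith
  have hξ0 : 0 < ξ := lt_of_le_of_lt (by positivity) hξ
  have hex := fun j : ℝ => fun hj : 0 ≤ j =>
    h.exists_hasSum_integral_exp_neg hl₁ hl₂ hπ hν₁ hν₂ hL hm₁ hm
      (show m ^ 2 / 4 < ξ + j by linarith)
  obtain ⟨K₀, hK₀, hF₀⟩ := h.exists_hasSum_integral_exp_neg hl₁ hl₂ hπ hν₁ hν₂ hL hm₁ hm hξ
  obtain ⟨K₁, hK₁, hF₁⟩ := hex 1 (by norm_num)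
  obtain ⟨K₂, hK₂, hF₂⟩ := hex 2 (by norm_num)
  obtain ⟨K₃, hK₃, hF₃⟩ := hex 3 (by norm_num)
  obtain ⟨K₄, hK₄, hF₄⟩ := hex 4 (by norm_num)
  have hint : ∀ j : ℝ, 0 ≤ j → Integrable (fun u => Real.exp (-(L * (ξ + j)) * u)) ν₂ := by
    intro j hj
    refine Integrable.of_bound (by fun_prop) 1 ?_
    filter_upwards [hν₂] with u hu
    rw [Real.norm_of_nonneg (Real.exp_pos _).le, Real.exp_le_one_iff]
    have : 0 ≤ L * (ξ + j) * u := by positivity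
    linarith
  have hexpand := integral_exp_mul_one_sub_exp_pow_four hint
  set p : ℝ → ℝ := fun x => x * (x + 1 - m) * (x + 1 + m) with hp
  have hcomb := ((((hK₀.mul_left (p ξ)).sub ((hK₁.mul_left (p (ξ + 1))).mul_left 4)).add
    ((hK₂.mul_left (p (ξ + 2))).mul_left 6)).sub ((hK₃.mul_left (p (ξ + 3))).mul_left 4)).add
    (hK₄.mul_left (p (ξ + 4)))
  have hpos : ∀ n : ℤ, 0 < ξ + ((n : ℝ) ^ 2 + m * n) := fun n =>
    add_pos_of_pos_of_nonneg hξ0 (int_sq_add_mul_nonneg hmpos.le hm_lt.le n)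
  have hdiff := fun n : ℤ => fourth_difference_cubic_div (hpos n)
    (f := fun x => p x * ((2 * n + m) / (x + (n ^ 2 + m * n)))) (fun x => rfl)
  have hsumm := ((summable_boundaryTerm hmpos.le hm_lt.le hξ).hasSum.mul_left (-2)).nat_add_neg
  have hshift := (hasSum_nat_add_iff' 1).2 hsumm
  have huniq := hcomb.unique (by
    convert hshift using 1
    funext n
    rw [← hdiff, ← hdiff]
    push_cast
    ring)
  have hzero := hdiff 0
  simp only [Finset.range_one, Finset.sum_singleton, Nat.cast_zero, neg_zero] at huniq
  simp only [Int.cast_zero, mul_zero, zero_add, add_zero, ne_eq, OfNat.ofNat_ne_zero,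
    not_false_eq_true, zero_pow] at hzero
  rw [hexpand]
  have hF : ∀ x K Φ : ℝ, 3 * m₁ * m * Φ = 2 * L * (x * (x + 1 - m) * (x + 1 + m)) * K →
      3 * m₁ * m * Φ = 2 * L * (p x * K) := fun x K Φ hx => by rw [hx]; ring
  have g₀ := hF _ _ _ hF₀
  have g₁ := hF _ _ _ hF₁
  have g₂ := hF _ _ _ hF₂
  have g₃ := hF _ _ _ hF₃
  have g₄ := hF _ _ _ hF₄
  linear_combination g₀ - 4 * g₁ + 6 * g₂ - 4 * g₃ + g₄ + 2 * L * huniq + 2 * L * hzero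

end Differences

section Density

open Filter Topology

theorem integrable_tsum_of_summable_integral_norm {α ι : Type*} {_ : MeasurableSpace α}
    {μ : Measure α} [Countable ι] {F : ι → α → ℝ} (hmeas : ∀ i, Measurable (F i))
    (hint : ∀ i, Integrable (F i) μ) (hsum : Summable fun i => ∫ a, ‖F i a‖ ∂μ) :
    Integrable (fun a => ∑' i, F i a) μ := by
  refine ⟨(Measurable.tsum hmeas).aestronglyMeasurable, ?_⟩
  have hle : ∫⁻ a, ‖∑' i, F i a‖ₑ ∂μ ≤ ∑' i, ∫⁻ a, ‖F i a‖ₑ ∂μ := by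
    rw [← lintegral_tsum fun i => (hmeas i).enorm.aemeasurable]
    exact lintegral_mono fun a => enorm_tsum_le_tsum_enorm
  refine lt_of_le_of_lt hle ?_
  have h : ∀ i, ∫⁻ a, ‖F i a‖ₑ ∂μ = ENNReal.ofReal (∫ a, ‖F i a‖ ∂μ) := fun i =>
    (ofReal_integral_norm_eq_lintegral_enorm (hint i)).symm
  simp only [h]
  exact hsum.tsum_ofReal_lt_top

theorem integrableOn_exp_mul_one_sub_exp_pow_four {L η : ℝ} (hL : 0 < L) (hη : 0 < η) :
    IntegrableOn (fun u => Real.exp (-(L * η) * u) * (1 - Real.exp (-L * u)) ^ 4) (Ioi 0) := by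
  have hint : ∀ j : ℝ, 0 ≤ j →
      Integrable (fun u => Real.exp (-(L * (η + j)) * u)) (volume.restrict (Ioi 0)) := fun j hj =>
    integrableOn_exp_mul_Ioi (neg_lt_zero.2 (by positivity)) 0
  have i₀ : Integrable (fun u => Real.exp (-(L * η) * u)) (volume.restrict (Ioi 0)) := by
    simpa using hint 0 le_rfl
  have i₁ := hint 1 (by norm_num)
  have i₂ := hint 2 (by norm_num)
  have i₃ := hint 3 (by norm_num)
  have i₄ := hint 4 (by norm_num)
  simp only [IntegrableOn, exp_mul_one_sub_exp_pow_four]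
  fun_prop

theorem integral_Ioi_exp_mul_one_sub_exp_pow_four {L η : ℝ} (hL : 0 < L) (hη : 0 < η) :
    ∫ u in Ioi 0, Real.exp (-(L * η) * u) * (1 - Real.exp (-L * u)) ^ 4
      = 24 / (η * (η + 1) * (η + 2) * (η + 3) * (η + 4)) / L := by
  have hint : ∀ j : ℝ, 0 ≤ j →
      Integrable (fun u => Real.exp (-(L * (η + j)) * u)) (volume.restrict (Ioi 0)) := fun j hj =>
    integrableOn_exp_mul_Ioi (neg_lt_zero.2 (by positivity)) 0
  have hval : ∀ c : ℝ, 0 < c → ∫ u in Ioi 0, Real.exp (-(L * c) * u) = 1 / c / L := by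
    intro c hc
    rw [integral_exp_mul_Ioi (neg_lt_zero.2 (by positivity)) 0]
    simp
    field_simp
  rw [integral_exp_mul_one_sub_exp_pow_four hint, hval _ hη, hval _ (by positivity),
    hval _ (by positivity), hval _ (by positivity), hval _ (by positivity),
    ← fourth_difference_inv hη]
  ring

theorem measurable_boundaryDensity (l₁ l₂ m : ℝ) : Measurable (boundaryDensity l₁ l₂ m) := by
  unfold boundaryDensity
  exact (Measurable.tsum fun n => by fun_prop).const_mul _

theorem exp_mul_boundaryDensity {l₁ l₂ L m ξ : ℝ} (hL : L = l₁ + l₂) (u : ℝ) :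
    Real.exp (-(L * ξ) * u) * (1 - Real.exp (-L * u)) ^ 4 * boundaryDensity l₁ l₂ m u
      = ∑' n : ℤ, -(4 * L ^ 4 / (3 * l₁ * l₂)) * boundaryCoeff m n *
        (Real.exp (-(L * (ξ + (n ^ 2 + m * n))) * u) * (1 - Real.exp (-L * u)) ^ 4) := by
  rw [boundaryDensity, ← hL, ← tsum_mul_left, ← tsum_mul_left]
  refine tsum_congr fun n => ?_
  have e : Real.exp (-(L * (ξ + (n ^ 2 + m * n))) * u)
      = Real.exp (-(L * ξ) * u) * Real.exp (-(((n : ℝ) ^ 2 + m * n) * L * u)) := by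
    rw [← Real.exp_add]
    ring_nf
  rw [e, boundaryCoeff]
  ring

theorem hasSum_integral_exp_mul_boundaryDensity {l₁ l₂ L m ξ : ℝ} (hL : L = l₁ + l₂)
    (hLpos : 0 < L) (hm₀ : 0 ≤ m) (hm₁ : m ≤ 1) (hξ : m ^ 2 / 4 < ξ) :
    IntegrableOn (fun u => Real.exp (-(L * ξ) * u) * (1 - Real.exp (-L * u)) ^ 4 *
      boundaryDensity l₁ l₂ m u) (Ioi 0) ∧
    HasSum (fun n => -(4 * L ^ 3 / (3 * l₁ * l₂)) * boundaryTerm m ξ n)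
      (∫ u in Ioi 0, Real.exp (-(L * ξ) * u) * (1 - Real.exp (-L * u)) ^ 4 *
        boundaryDensity l₁ l₂ m u) := by
  have hξ0 : 0 < ξ := lt_of_le_of_lt (by positivity) hξ
  have hpos : ∀ n : ℤ, 0 < ξ + ((n : ℝ) ^ 2 + m * n) := fun n =>
    add_pos_of_pos_of_nonneg hξ0 (int_sq_add_mul_nonneg hm₀ hm₁ n)
  set F : ℤ → ℝ → ℝ := fun n u => -(4 * L ^ 4 / (3 * l₁ * l₂)) * boundaryCoeff m n *
    (Real.exp (-(L * (ξ + (n ^ 2 + m * n))) * u) * (1 - Real.exp (-L * u)) ^ 4) with hF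
  have hmeas : ∀ n, Measurable (F n) := fun n => by simp only [hF]; fun_prop
  have hint : ∀ n, Integrable (F n) (volume.restrict (Ioi 0)) := fun n =>
    (integrableOn_exp_mul_one_sub_exp_pow_four hLpos (hpos n)).const_mul _
  have hval : ∀ n, ∫ u in Ioi 0, F n u = -(4 * L ^ 3 / (3 * l₁ * l₂)) * boundaryTerm m ξ n := by
    intro n
    simp only [hF]
    rw [integral_const_mul, integral_Ioi_exp_mul_one_sub_exp_pow_four hLpos (hpos n), boundaryTerm]
    field_simp
  have hnorm : ∀ n, ∫ u in Ioi 0, ‖F n u‖ = |∫ u in Ioi 0, F n u| := by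
    intro n
    simp only [hF, integral_const_mul, norm_mul, abs_mul, Real.norm_eq_abs]
    congr 1
    rw [abs_of_nonneg (integral_nonneg fun u => by positivity)]
    refine integral_congr_ae (Eventually.of_forall fun u => ?_)
    simp only [Real.abs_exp]
    rw [abs_of_nonneg (by positivity)]
  have hsum : Summable fun n => ∫ u in Ioi 0, ‖F n u‖ := by
    simp only [hnorm, hval]
    exact ((summable_boundaryTerm hm₀ hm₁ hξ).mul_left _).abs
  simp only [exp_mul_boundaryDensity hL]
  refine ⟨integrable_tsum_of_summable_integral_norm hmeas hint hsum, ?_⟩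
  simpa only [hval] using hasSum_integral_of_summable_integral_norm hint hsum

/-- A finite measure on the positive half-line whose Laplace transform is that of an integrable
function `g` has density `g`. -/
theorem eq_withDensity_of_integral_exp_neg_eq {μ : Measure ℝ} [IsFiniteMeasure μ]
    (hμ : ∀ᵐ u ∂μ, 0 < u) {g : ℝ → ℝ} (hg : Measurable g) (hgi : IntegrableOn g (Ioi 0))
    (h : ∀ t > 0, ∫ u, Real.exp (-t * u) ∂μ = ∫ u in Ioi 0, Real.exp (-t * u) * g u) :
    μ = (volume.restrict (Ioi 0)).withDensity fun u => ENNReal.ofReal (g u) := by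
  set V : Measure ℝ := volume.restrict (Ioi 0) with hV
  set P := V.withDensity fun u => ENNReal.ofReal (g u) with hP
  set N := V.withDensity fun u => ENNReal.ofReal (-g u) with hN
  have hPf : IsFiniteMeasure P := isFiniteMeasure_withDensity_ofReal hgi.2
  have hNf : IsFiniteMeasure N := isFiniteMeasure_withDensity_ofReal hgi.neg.2
  have hVpos : ∀ᵐ u ∂V, 0 < u := ae_restrict_mem measurableSet_Ioi
  have hPpos : ∀ᵐ u ∂P, 0 < u := (withDensity_absolutelyContinuous V _).ae_le hVpos
  have hNpos : ∀ᵐ u ∂N, 0 < u := (withDensity_absolutelyContinuous V _).ae_le hVpos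
  have hexp_int : ∀ {ρ : Measure ℝ} [IsFiniteMeasure ρ], (∀ᵐ u ∂ρ, 0 < u) → ∀ t > 0,
      Integrable (fun u => Real.exp (-t * u)) ρ := by
    intro ρ _ hρ t ht
    refine Integrable.of_bound (by fun_prop) 1 ?_
    filter_upwards [hρ] with u hu
    rw [Real.norm_of_nonneg (Real.exp_pos _).le, Real.exp_le_one_iff]
    have : 0 ≤ t * u := by positivity
    linarith
  have hwd : ∀ {k : ℝ → ℝ}, Measurable k → ∀ t : ℝ,
      ∫ u, Real.exp (-t * u) ∂(V.withDensity fun u => ENNReal.ofReal (k u))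
        = ∫ u, max (k u) 0 * Real.exp (-t * u) ∂V := by
    intro k hk t
    rw [integral_withDensity_eq_integral_toReal_smul (by fun_prop) (by simp)]
    simp [ENNReal.toReal_ofReal']
  have hdom : ∀ {k : ℝ → ℝ}, Measurable k → Integrable k V → ∀ t > 0,
      Integrable (fun u => max (k u) 0 * Real.exp (-t * u)) V := by
    intro k hk hki t ht
    refine hki.mono (by fun_prop) ?_
    filter_upwards [hVpos] with u hu
    have h1 : Real.exp (-t * u) ≤ 1 := by
      rw [Real.exp_le_one_iff]
      have : 0 ≤ t * u := by positivity
      linarith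
    rw [norm_mul, Real.norm_of_nonneg (le_max_right _ _), Real.norm_of_nonneg (Real.exp_pos _).le,
      Real.norm_eq_abs]
    have h2 : max (k u) 0 ≤ |k u| := max_le (le_abs_self _) (abs_nonneg _)
    calc max (k u) 0 * Real.exp (-t * u) ≤ |k u| * 1 := by gcongr
      _ = |k u| := mul_one _
  have hadd : μ + N = P := by
    refine ext_of_integral_exp_neg_eq (ae_add_measure_iff.2 ⟨hμ, hNpos⟩) hPpos fun t ht => ?_
    rw [integral_add_measure (hexp_int hμ t ht) (hexp_int hNpos t ht), h t ht, hwd hg,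
      show ∫ u, Real.exp (-t * u) ∂N = _ from hwd hg.neg t, ← eq_sub_iff_add_eq,
      ← integral_sub (hdom hg hgi t ht) (hdom hg.neg hgi.neg t ht)]
    refine integral_congr_ae (Eventually.of_forall fun u => ?_)
    simp only [Pi.neg_apply]
    rcases le_total 0 (g u) with hu | hu
    · rw [max_eq_left hu, max_eq_right (by linarith)]; ring
    · rw [max_eq_right hu, max_eq_left (by linarith)]; ring
  have hset : MeasurableSet {u | g u < 0} := measurableSet_lt hg measurable_const
  have hP0 : P {u | g u < 0} = 0 := by
    rw [hP, withDensity_apply _ hset]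
    refine setLIntegral_eq_zero hset fun u hu => ?_
    exact ENNReal.ofReal_of_nonpos (le_of_lt hu)
  have hN0 : N = 0 := by
    rw [← Measure.measure_univ_eq_zero, ← union_compl_self {u | g u < 0}]
    refine measure_union_null ?_ ?_
    · have : N {u | g u < 0} ≤ P {u | g u < 0} := by
        rw [← hadd]; exact Measure.le_add_left le_rfl _
      exact le_antisymm (this.trans hP0.le) bot_le
    · rw [hN, withDensity_apply _ hset.compl]
      refine setLIntegral_eq_zero hset.compl fun u hu => ?_
      exact ENNReal.ofReal_of_nonpos (by simpa using hu)
  rw [← hadd, hN0, add_zero]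

end Density

section Main

open Filter Topology

variable {l₁ l₂ : ℝ} {π : Measure (ℝ × ℝ)} {ν₁ ν₂ : Measure ℝ}

theorem withDensity_right_cancel {α : Type*} {_ : MeasurableSpace α} {μ ρ : Measure α}
    {f : α → ENNReal} (hf : Measurable f) (hμ : ∀ᵐ x ∂μ, f x ≠ 0) (hρ : ∀ᵐ x ∂ρ, f x ≠ 0)
    (hf_top : ∀ x, f x ≠ ⊤) (h : μ.withDensity f = ρ.withDensity f) : μ = ρ := by
  rw [← withDensity_inv_same hf hμ (Eventually.of_forall hf_top), h,
    withDensity_inv_same hf hρ (Eventually.of_forall hf_top)]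

theorem BasicAdjointRelationship.eq_withDensity_boundaryDensity [IsProbabilityMeasure π]
    [IsFiniteMeasure ν₁] [IsFiniteMeasure ν₂] (h : BasicAdjointRelationship l₁ l₂ π ν₁ ν₂)
    (hl₁ : 0 < l₁) (hl₂ : 0 < l₂)
    (hπ : ∀ᵐ p ∂π, 0 < p.1 ∧ 0 < p.2) (hν₁ : ∀ᵐ u ∂ν₁, 0 < u) (hν₂ : ∀ᵐ u ∂ν₂, 0 < u) :
    ν₂ = (volume.restrict (Ioi 0)).withDensity
      fun u => ENNReal.ofReal (boundaryDensity l₁ l₂ (l₂ / (l₁ + l₂)) u) := by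
  obtain ⟨L, hL⟩ : ∃ L, L = l₁ + l₂ := ⟨_, rfl⟩
  rw [← hL]
  obtain ⟨m, hm⟩ : ∃ m, m = l₂ / L := ⟨_, rfl⟩
  obtain ⟨m₁, hm₁⟩ : ∃ m₁, m₁ = l₁ / L := ⟨_, rfl⟩
  rw [← hm]
  have hLpos : 0 < L := by rw [hL]; positivity
  have hmpos : 0 < m := by rw [hm]; positivity
  have hm₁pos : 0 < m₁ := by rw [hm₁]; positivity
  have hm_lt : m < 1 := by rw [hm, hL, div_lt_one (by positivity)]; linarith
  have e₁ : l₁ = L * m₁ := by rw [hm₁]; field_simp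
  have e₂ : l₂ = L * m := by rw [hm]; field_simp
  have hfm := measurable_boundaryDensity l₁ l₂ m
  -- both sides have the same weighted transform
  have htransform : ∀ ξ, m ^ 2 / 4 < ξ →
      ∫ u, Real.exp (-(L * ξ) * u) * (1 - Real.exp (-L * u)) ^ 4 ∂ν₂
        = ∫ u in Ioi 0, Real.exp (-(L * ξ) * u) * (1 - Real.exp (-L * u)) ^ 4 *
          boundaryDensity l₁ l₂ m u := by
    intro ξ hξ
    have h1 := h.integral_exp_mul_pow_four hl₁ hl₂ hπ hν₁ hν₂ hL hm₁ hm hξ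
    have h2 := (hasSum_integral_exp_mul_boundaryDensity hL hLpos hmpos.le hm_lt.le hξ).2.tsum_eq
    rw [tsum_mul_left] at h2
    rw [← h2]
    apply mul_left_cancel₀ (by positivity : 3 * m₁ * m ≠ 0)
    rw [h1, e₁, e₂]
    field_simp
  have hone : m ^ 2 / 4 < 1 := by nlinarith
  set w : ℝ → ℝ := fun u => Real.exp (-(L * 1) * u) * (1 - Real.exp (-L * u)) ^ 4 with hw
  have hwm : Measurable w := by rw [hw]; fun_prop
  have hw0 : ∀ u, 0 ≤ w u := fun u => by simp only [hw]; positivity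
  have hexp_le : ∀ c u : ℝ, 0 < c → 0 < u → Real.exp (-c * u) < 1 := by
    intro c u hc hu
    rw [Real.exp_lt_one_iff]
    have : 0 < c * u := by positivity
    linarith
  have hwpos : ∀ u, 0 < u → 0 < w u := by
    intro u hu
    have := hexp_le L u hLpos hu
    exact mul_pos (Real.exp_pos _) (pow_pos (by linarith) _)
  have hwle : ∀ u, 0 < u → w u ≤ 1 := by
    intro u hu
    have h1 := hexp_le L u hLpos hu
    have h2 := hexp_le (L * 1) u (by linarith) hu
    have h3 := Real.exp_pos (-L * u)
    exact mul_le_one₀ h2.le (by positivity) (pow_le_one₀ (by linarith) (by linarith))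
  have hwint : Integrable w ν₂ := by
    refine Integrable.of_bound hwm.aestronglyMeasurable 1 ?_
    filter_upwards [hν₂] with u hu
    rw [Real.norm_of_nonneg (hw0 u)]
    exact hwle u hu
  set W : ℝ → ENNReal := fun u => ENNReal.ofReal (w u) with hW
  have hWm : Measurable W := hwm.ennreal_ofReal
  have hfin : IsFiniteMeasure (ν₂.withDensity W) := isFiniteMeasure_withDensity_ofReal hwint.2
  have hshift : ∀ t u : ℝ, w u * Real.exp (-t * u)
      = Real.exp (-(L * (1 + t / L)) * u) * (1 - Real.exp (-L * u)) ^ 4 := by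
    intro t u
    simp only [hw]
    rw [mul_right_comm, ← Real.exp_add]
    congr 2
    field_simp
    ring
  have hmain := eq_withDensity_of_integral_exp_neg_eq (μ := ν₂.withDensity W)
    ((withDensity_absolutelyContinuous ν₂ W).ae_le hν₂) (hwm.mul hfm)
    (hasSum_integral_exp_mul_boundaryDensity hL hLpos hmpos.le hm_lt.le hone).1 (by
      intro t ht
      rw [integral_withDensity_eq_integral_toReal_smul hWm (by simp [hW])]
      have ht' : 0 < t / L := by positivity
      have e := htransform (1 + t / L) (by linarith)
      simp only [← hshift] at e
      simp only [hW, ENNReal.toReal_ofReal (hw0 _), smul_eq_mul]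
      rw [e]
      refine integral_congr_ae (Eventually.of_forall fun u => ?_)
      simp only [Pi.mul_apply]
      ring)
  have hWne : ∀ {ρ : Measure ℝ}, (∀ᵐ u ∂ρ, 0 < u) → ∀ᵐ u ∂ρ, W u ≠ 0 := fun hρ =>
    hρ.mono fun u hu => by simpa [hW] using hwpos u hu
  refine withDensity_right_cancel hWm (hWne hν₂) (hWne ?_) (by simp [hW]) ?_
  · exact (withDensity_absolutelyContinuous _ _).ae_le (ae_restrict_mem measurableSet_Ioi)
  · rw [hmain, ← withDensity_mul _ hfm.ennreal_ofReal hWm]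
    congr 1
    funext u
    simp only [Pi.mul_apply, hW]
    rw [ENNReal.ofReal_mul (hw0 u), mul_comm]

theorem boundaryDensity_swap (l₁ l₂ m u : ℝ) :
    boundaryDensity l₂ l₁ m u = boundaryDensity l₁ l₂ m u := by
  rw [boundaryDensity, boundaryDensity, add_comm l₂ l₁, mul_right_comm 3 l₂ l₁]

end Main

/-- Theorem 2 (density on the boundary, general case): if `(π, ν1, ν2)` satisfies the basic
adjoint relationship, then for `i ∈ {1,2}` the measure `νi` is absolutely continuous with
respect to Lebesgue measure on `(0,∞)`, with the stated density (with `μi = λi/(λ1+λ2)`). -/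
theorem boundary_density_general
    (l1 l2 : ℝ) (hl1 : 0 < l1) (hl2 : 0 < l2)
    (pim : Measure (ℝ × ℝ)) [IsProbabilityMeasure pim]
    (hpim : pim ((Ioi (0:ℝ) ×ˢ Ioi (0:ℝ))ᶜ) = 0)
    (nu1 nu2 : Measure ℝ) [IsFiniteMeasure nu1] [IsFiniteMeasure nu2]
    (hnu1 : nu1 (Ioi (0:ℝ))ᶜ = 0) (hnu2 : nu2 (Ioi (0:ℝ))ᶜ = 0)
    (hBAR : ∀ x ≥ (0:ℝ), ∀ y ≥ (0:ℝ),
      ((x - y) ^ 2 + l1 * x + l2 * y) * (∫ p, Real.exp (-x * p.1 - y * p.2) ∂pim)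
        = (x - y / 2) * (∫ u, Real.exp (-y * u) ∂nu1)
          + (y - x / 2) * (∫ u, Real.exp (-x * u) ∂nu2)) :
    nu1 = (volume.restrict (Ioi (0:ℝ))).withDensity
        (fun u => ENNReal.ofReal (boundaryDensity l1 l2 (l1 / (l1 + l2)) u)) ∧
    nu2 = (volume.restrict (Ioi (0:ℝ))).withDensity
        (fun u => ENNReal.ofReal (boundaryDensity l1 l2 (l2 / (l1 + l2)) u)) := by
  have h : BasicAdjointRelationship l1 l2 pim nu1 nu2 := hBAR
  have hpos : ∀ᵐ p ∂pim, 0 < p.1 ∧ 0 < p.2 := hpim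
  have hpos1 := ae_pos_of_compl_Ioi hnu1
  have hpos2 := ae_pos_of_compl_Ioi hnu2
  have : IsProbabilityMeasure (pim.map Prod.swap) :=
    Measure.isProbabilityMeasure_map (by fun_prop)
  refine ⟨?_, h.eq_withDensity_boundaryDensity hl1 hl2 hpos hpos1 hpos2⟩
  have hswap := h.swap.eq_withDensity_boundaryDensity hl2 hl1 (ae_pos_map_swap hpos) hpos2 hpos1
  simpa only [boundaryDensity_swap l1 l2, add_comm l2 l1] using hswap
end
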